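/- arXiv:0904.2447 — 9 statements merged into one kernel-verified Lean document; each statement's English description precedes it below -/
import Mathlib

section
/- Let n ≥ 3, H ⊆ Sym_n, M = S_n(H), z = a_1⋯a_n, and suppose z^m is central in M for some positive integer m. Define the relation ρ' on M by s ρ' t iff s z^i = t z^i for some nonnegative integer i. Then ρ' is the least cancellative congruence on M, and M/ρ' is a cancellative monoid with group of fractions isomorphic to the group G_n(H) defined by the same presentation. -/
/-- The defining relation of `Sₙ(H)`: the word `a₁a₂⋯aₙ` equals the word
`a_{σ(1)}a_{σ(2)}⋯a_{σ(n)}` for every `σ ∈ H`. -/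
def SnRel (n : ℕ) (H : Set (Equiv.Perm (Fin n))) :
    FreeMonoid (Fin n) → FreeMonoid (Fin n) → Prop := fun x y =>
  ∃ σ ∈ H, x = FreeMonoid.ofList (List.ofFn (fun i : Fin n => i)) ∧
    y = FreeMonoid.ofList (List.ofFn (fun i : Fin n => σ i))

/-- The congruence generated by the defining relations. -/
def SnCon (n : ℕ) (H : Set (Equiv.Perm (Fin n))) : Con (FreeMonoid (Fin n)) :=
  conGen (SnRel n H)

/-- The monoid `Sₙ(H) = ⟨a₁,…,aₙ ∣ a₁a₂⋯aₙ = a_{σ(1)}⋯a_{σ(n)}, σ ∈ H⟩`. -/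
abbrev Sn (n : ℕ) (H : Set (Equiv.Perm (Fin n))) : Type := (SnCon n H).Quotient

/-- The generator `aᵢ` of `Sₙ(H)`. -/
def gen (n : ℕ) (H : Set (Equiv.Perm (Fin n))) (i : Fin n) : Sn n H :=
  (SnCon n H).mk' (FreeMonoid.of i)

/-- The element `z = a₁a₂⋯aₙ` of `Sₙ(H)`. -/
def zel (n : ℕ) (H : Set (Equiv.Perm (Fin n))) : Sn n H :=
  (SnCon n H).mk' (FreeMonoid.ofList (List.ofFn (fun i : Fin n => i)))

/-- The relator set of `Gₙ(H)`. -/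
def GnRels (n : ℕ) (H : Set (Equiv.Perm (Fin n))) : Set (FreeGroup (Fin n)) :=
  { w | ∃ σ ∈ H,
      w = (List.ofFn (fun i : Fin n => FreeGroup.of i)).prod *
        ((List.ofFn (fun i : Fin n => FreeGroup.of (σ i))).prod)⁻¹ }

/-- The group `Gₙ(H)` defined by the same presentation as `Sₙ(H)`. -/
abbrev Gn (n : ℕ) (H : Set (Equiv.Perm (Fin n))) : Type := PresentedGroup (GnRels n H)

namespace Sn

variable {n : ℕ} {H : Set (Equiv.Perm (Fin n))}

/-- Two words that form a defining relation give the same element of `Sₙ(H)`. -/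
theorem mk'_ofFn_perm {σ : Equiv.Perm (Fin n)} (hσ : σ ∈ H) :
    (SnCon n H).mk' (FreeMonoid.ofList (List.ofFn (fun i : Fin n => σ i))) = zel n H :=
  ((Con.eq _).2 (ConGen.Rel.of _ _ ⟨σ, hσ, rfl, rfl⟩)).symm

/-- The image of a word is the product of the images of its letters. -/
theorem map_ofList {M N : Type*} [Monoid M] [Monoid N] (f : FreeMonoid (Fin n) →* M)
    (g : M →* N) (l : List (Fin n)) :
    g (f (FreeMonoid.ofList l)) = (l.map fun i => g (f (FreeMonoid.of i))).prod := by
  induction l with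
  | nil => simp
  | cons a l ih => rw [FreeMonoid.ofList_cons, map_mul, map_mul, ih, List.map_cons, List.prod_cons]

/-- A homomorphism out of `Sₙ(H)` from a family satisfying the defining relations. -/
def lift {N : Type*} [Monoid N] (f : Fin n → N)
    (hf : ∀ σ ∈ H, (List.ofFn f).prod = (List.ofFn fun i => f (σ i)).prod) :
    Sn n H →* N :=
  (SnCon n H).lift (FreeMonoid.lift f) <| Con.conGen_le.2 <| by
    rintro _ _ ⟨σ, hσ, rfl, rfl⟩
    simpa [Con.ker_rel, FreeMonoid.lift_ofList, List.map_ofFn, Function.comp_def] using hf σ hσ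

@[simp]
theorem lift_gen {N : Type*} [Monoid N] (f : Fin n → N)
    (hf : ∀ σ ∈ H, (List.ofFn f).prod = (List.ofFn fun i => f (σ i)).prod) (i : Fin n) :
    lift f hf (gen n H i) = f i :=
  ((SnCon n H).lift_mk' _ _).trans (FreeMonoid.lift_eval_of f i)

theorem map_zel {N : Type*} [Monoid N] (g : Sn n H →* N) :
    g (zel n H) = (List.ofFn fun i => g (gen n H i)).prod := by
  rw [zel, map_ofList, List.map_ofFn]
  rfl

theorem map_zel_perm {N : Type*} [Monoid N] (g : Sn n H →* N) {σ : Equiv.Perm (Fin n)}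
    (hσ : σ ∈ H) : g (zel n H) = (List.ofFn fun i => g (gen n H (σ i))).prod := by
  rw [← mk'_ofFn_perm hσ, map_ofList, List.map_ofFn]
  rfl

@[elab_as_elim]
theorem induction {p : Sn n H → Prop} (one : p 1) (gen_mul : ∀ i x, p x → p (gen n H i * x))
    (x : Sn n H) : p x := by
  induction x using Con.induction_on with
  | H w =>
    induction w using FreeMonoid.inductionOn' with
    | one => exact one
    | of_mul i w hw => exact gen_mul i _ hw

@[ext]
theorem hom_ext {N : Type*} [Monoid N] {f g : Sn n H →* N}
    (h : ∀ i, f (gen n H i) = g (gen n H i)) : f = g := by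
  refine MonoidHom.ext fun x => ?_
  induction x using Sn.induction with
  | one => simp
  | gen_mul i x hx => rw [map_mul, map_mul, h, hx]

/-- The action of words on `Prop` that detects whether a word starts with the letter `i`. -/
def firstLetter (i j : Fin n) : Function.End Prop := fun _ => j = i

theorem firstLetter_mul (i j : Fin n) (f : Function.End Prop) :
    firstLetter i j * f = firstLetter i j := rfl

/-- If a positive power of `z` is central, then every generator is a left divisor of `z`. -/
theorem gen_dvd_zel {m : ℕ} (hm : 0 < m)
    (hcent : ∀ x : Sn n H, zel n H ^ m * x = x * zel n H ^ m) (i : Fin n) :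
    gen n H i ∣ zel n H := by
  obtain ⟨k, rfl⟩ : ∃ k, n = k + 1 := ⟨n - 1, by have := i.pos; omega⟩
  by_cases h0 : i = 0
  · subst h0
    have := map_zel (MonoidHom.id (Sn (k + 1) H))
    rw [List.ofFn_succ, List.prod_cons] at this
    exact ⟨_, this⟩
  by_cases hσ : ∃ σ ∈ H, σ 0 = i
  · obtain ⟨σ, hσ, rfl⟩ := hσ
    have := map_zel_perm (MonoidHom.id (Sn (k + 1) H)) hσ
    rw [List.ofFn_succ, List.prod_cons] at this
    exact ⟨_, this⟩
  exfalso
  push Not at hσ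
  have hrel : ∀ σ ∈ H, (List.ofFn (firstLetter i)).prod =
      (List.ofFn fun j => firstLetter i (σ j)).prod := by
    intro σ hs
    rw [List.ofFn_succ, List.prod_cons, List.ofFn_succ, List.prod_cons, firstLetter_mul,
      firstLetter_mul]
    funext
    simp [firstLetter, hσ σ hs, Ne.symm h0]
  have hz : lift (firstLetter i) hrel (zel _ H) = firstLetter i 0 := by
    rw [map_zel, List.ofFn_succ, List.prod_cons, lift_gen, firstLetter_mul]
  have h := congrArg (lift (firstLetter i) hrel) (hcent (gen _ H i))
  obtain ⟨l, rfl⟩ : ∃ l, m = l + 1 := ⟨m - 1, by omega⟩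
  rw [map_mul, map_mul, map_pow, hz, lift_gen, firstLetter_mul, pow_succ', mul_assoc,
    firstLetter_mul] at h
  have := congrFun h True
  simp [firstLetter, Ne.symm h0] at this

theorem exists_mul_eq_pow {m : ℕ} (hm : 0 < m)
    (hcent : ∀ x : Sn n H, zel n H ^ m * x = x * zel n H ^ m) (x : Sn n H) :
    ∃ y, ∃ k : ℕ, x * y = (zel n H ^ m) ^ k := by
  induction x using Sn.induction with
  | one => exact ⟨1, 0, by simp⟩
  | gen_mul i x hx =>
    obtain ⟨y, k, hy⟩ := hx
    obtain ⟨w, hw⟩ := gen_dvd_zel hm hcent i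
    refine ⟨y * (w * zel n H ^ (m - 1)), k + 1, ?_⟩
    have hc : gen n H i * (zel n H ^ m) ^ k = (zel n H ^ m) ^ k * gen n H i :=
      ((show Commute (zel n H ^ m) (gen n H i) from hcent _).pow_left k).eq.symm
    calc gen n H i * x * (y * (w * zel n H ^ (m - 1)))
        = gen n H i * (x * y) * (w * zel n H ^ (m - 1)) := by simp only [mul_assoc]
      _ = (zel n H ^ m) ^ k * (gen n H i * w * zel n H ^ (m - 1)) := by
        rw [hy, hc]; simp only [mul_assoc]
      _ = (zel n H ^ m) ^ (k + 1) := by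
        rw [← hw, ← pow_succ', Nat.sub_add_cancel hm, ← pow_succ]

/-- The canonical homomorphism `Sₙ(H) → Gₙ(H)`. -/
def toGn (n : ℕ) (H : Set (Equiv.Perm (Fin n))) : Sn n H →* Gn n H :=
  lift PresentedGroup.of <| by
    intro σ hσ
    have h : PresentedGroup.mk (GnRels n H) _ = 1 :=
      PresentedGroup.one_of_mem ⟨σ, hσ, rfl⟩
    rw [map_mul, map_inv, mul_inv_eq_one, map_list_prod, map_list_prod, List.map_ofFn,
      List.map_ofFn] at h
    exact h

theorem toGn_gen (i : Fin n) : toGn n H (gen n H i) = PresentedGroup.of i := lift_gen _ _ i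

/-- A homomorphism from `Sₙ(H)` to a monoid that sends generators to units factors through
`Gₙ(H)`. -/
theorem exists_comp_toGn {N : Type*} [Monoid N] (f : Sn n H →* N)
    (hf : ∀ i, IsUnit (f (gen n H i))) :
    ∃ g : Gn n H →* Nˣ, ∀ x, (g (toGn n H x) : N) = f x := by
  choose u hu using hf
  have hrel : ∀ r ∈ GnRels n H, FreeGroup.lift u r = 1 := by
    rintro _ ⟨σ, hσ, rfl⟩
    rw [map_mul, map_inv, mul_inv_eq_one, map_list_prod, map_list_prod, List.map_ofFn,
      List.map_ofFn]
    apply Units.ext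
    have h := (map_zel f).symm.trans (map_zel_perm f hσ)
    rw [← Units.coeHom_apply, ← Units.coeHom_apply, map_list_prod, map_list_prod, List.map_ofFn,
      List.map_ofFn]
    simpa [Function.comp_def, hu] using h
  refine ⟨PresentedGroup.toGroup hrel, fun x => ?_⟩
  have : ((Units.coeHom N).comp (PresentedGroup.toGroup hrel)).comp (toGn n H) = f := by
    ext i
    simp [toGn_gen, hu]
  exact DFunLike.congr_fun this x

/-- The powers of a central element form an Ore set. -/
@[reducible]
def oreSetPowers {M : Type*} [Monoid M] {c : M} (hc : ∀ x, c * x = x * c) :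
    OreLocalization.OreSet (Submonoid.powers c) where
  ore_right_cancel r₁ r₂ s h := by
    obtain ⟨_, k, rfl⟩ := s
    have h' : ∀ x, c ^ k * x = x * c ^ k := fun x => ((show Commute c x from hc x).pow_left k).eq
    exact ⟨⟨_, k, rfl⟩, (h' _).trans (h.trans (h' _).symm)⟩
  oreNum r _ := r
  oreDenom _ s := s
  ore_eq r s := by
    obtain ⟨_, k, rfl⟩ := s
    exact ((show Commute c r from hc r).pow_left k).eq

theorem toGn_eq_iff {m : ℕ} (hm : 0 < m)
    (hcent : ∀ x : Sn n H, zel n H ^ m * x = x * zel n H ^ m) (s t : Sn n H) :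
    toGn n H s = toGn n H t ↔ ∃ i : ℕ, s * zel n H ^ i = t * zel n H ^ i := by
  constructor
  · intro h
    let := oreSetPowers hcent
    let f : Sn n H →* OreLocalization (Submonoid.powers (zel n H ^ m)) (Sn n H) :=
      OreLocalization.numeratorHom
    have hpow : ∀ k : ℕ, IsUnit (f ((zel n H ^ m) ^ k)) := fun k =>
      OreLocalization.numerator_isUnit (⟨_, k, rfl⟩ : Submonoid.powers (zel n H ^ m))
    have hright : ∀ x, ∃ b, f x * b = 1 := by
      intro x
      obtain ⟨y, k, hy⟩ := exists_mul_eq_pow hm hcent x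
      obtain ⟨b, hb⟩ := (hpow k).exists_right_inv
      exact ⟨f y * b, by rw [← mul_assoc, ← map_mul, hy, hb]⟩
    have hunit : ∀ x, IsUnit (f x) := by
      intro x
      obtain ⟨y, k, hy⟩ := exists_mul_eq_pow hm hcent x
      obtain ⟨b, hb⟩ := (hpow k).exists_left_inv
      obtain ⟨w, hw⟩ := hright y
      have hxy : IsUnit (f x * f y) := by rw [← map_mul, hy]; exact hpow k
      have hby : b * f x * f y = 1 := by rw [mul_assoc, ← map_mul, hy, hb]
      have hy : IsUnit (f y) := isUnit_iff_exists_and_exists.2 ⟨⟨w, hw⟩, ⟨_, hby⟩⟩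
      exact (Units.isUnit_mul_units _ hy.unit).1 hxy
    obtain ⟨g, hg⟩ := exists_comp_toGn f fun i => hunit _
    have hst : f s = f t := by rw [← hg, ← hg, h]
    obtain ⟨⟨_, k, rfl⟩, v, h₁, h₂⟩ := OreLocalization.oreDiv_eq_iff.1 hst
    have hv : v = (zel n H ^ m) ^ k := by simpa using h₂.symm
    subst hv
    have h' : ∀ x, (zel n H ^ m) ^ k * x = x * (zel n H ^ m) ^ k := fun x =>
      ((show Commute (zel n H ^ m) x from hcent x).pow_left k).eq
    refine ⟨m * k, ?_⟩
    rw [pow_mul, ← h', ← h']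
    exact h₁.symm
  · rintro ⟨i, h⟩
    have := congrArg (toGn n H) h
    rwa [map_mul, map_mul, mul_left_inj] at this

theorem exists_eq_toGn_mul {m : ℕ} (hm : 0 < m)
    (hcent : ∀ x : Sn n H, zel n H ^ m * x = x * zel n H ^ m) (g : Gn n H) :
    ∃ (x : Sn n H) (k : ℕ), g = toGn n H x * (toGn n H (zel n H ^ m))⁻¹ ^ k := by
  obtain ⟨w, rfl⟩ := PresentedGroup.mk_surjective _ g
  induction w using FreeGroup.induction_on with
  | C1 => exact ⟨1, 0, by simp⟩
  | of i => exact ⟨gen n H i, 0, by simp only [toGn_gen, pow_zero, mul_one]; rfl⟩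
  | inv_of i _ =>
    obtain ⟨y, k, hy⟩ := exists_mul_eq_pow hm hcent (gen n H i)
    refine ⟨y, k, ?_⟩
    have := congrArg (toGn n H) hy
    rw [map_mul, map_pow _ (zel n H ^ m)] at this
    rw [map_inv, inv_pow, ← this, mul_inv_rev, mul_inv_cancel_left, toGn_gen]
    rfl
  | mul x y hx hy =>
    obtain ⟨x', k, hx⟩ := hx
    obtain ⟨y', l, hy⟩ := hy
    refine ⟨x' * y', k + l, ?_⟩
    have hc : Commute (toGn n H (zel n H ^ m)) (toGn n H y') :=
      (show Commute (zel n H ^ m) y' from hcent y').map (toGn n H)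
    rw [map_mul, hx, hy, map_mul, pow_add]
    exact (hc.inv_left.pow_left k).mul_mul_mul_comm _ _

end Sn

/-- if `z^m` is central in `M = Sₙ(H)` (`m > 0`), then the relation
`ρ'` (`s ρ' t` iff `s zⁱ = t zⁱ` for some `i ≥ 0`) is the least cancellative
congruence on `M`, the quotient `M/ρ'` is cancellative, and `Gₙ(H)` is its group
of fractions, obtained by inverting `z^m`: the canonical monoid homomorphism
`M/ρ' → Gₙ(H)` is injective and every element of `Gₙ(H)` is of the form
`φ(x)·φ(z^m)⁻ᵏ`. -/
theorem stmt3 (n : ℕ) (hn : 3 ≤ n) (H : Set (Equiv.Perm (Fin n)))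
    (m : ℕ) (hm : 0 < m)
    (hcent : ∀ x : Sn n H, (zel n H) ^ m * x = x * (zel n H) ^ m) :
    ∃ c : Con (Sn n H),
      (∀ s t : Sn n H, c s t ↔ ∃ i : ℕ, s * (zel n H) ^ i = t * (zel n H) ^ i) ∧
      (∀ x y w : c.Quotient, x * w = y * w → x = y) ∧
      (∀ x y w : c.Quotient, w * x = w * y → x = y) ∧
      (∀ d : Con (Sn n H),
        ((∀ x y w : d.Quotient, x * w = y * w → x = y) ∧
          (∀ x y w : d.Quotient, w * x = w * y → x = y)) → c ≤ d) ∧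
      ∃ φ : c.Quotient →* Gn n H,
        Function.Injective φ ∧
        (∀ i : Fin n, φ (c.mk' (gen n H i)) = PresentedGroup.of i) ∧
        ∀ g : Gn n H, ∃ (x : Sn n H) (k : ℕ),
          g = φ (c.mk' x) * (φ (c.mk' ((zel n H) ^ m)))⁻¹ ^ k := by
  have hrel : ∀ s t, Con.ker (Sn.toGn n H) s t ↔
      ∃ i : ℕ, s * (zel n H) ^ i = t * (zel n H) ^ i := Sn.toGn_eq_iff hm hcent
  have hinj := Con.kerLift_injective (Sn.toGn n H)
  refine ⟨Con.ker (Sn.toGn n H), hrel, fun x y w h => hinj ?_, fun x y w h => hinj ?_, ?_,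
    Con.kerLift _, hinj, Sn.toGn_gen, Sn.exists_eq_toGn_mul hm hcent⟩
  · simpa using congrArg (Con.kerLift (Sn.toGn n H)) h
  · simpa using congrArg (Con.kerLift (Sn.toGn n H)) h
  · rintro d ⟨hd, -⟩ s t hst
    obtain ⟨i, h⟩ := (hrel s t).1 hst
    exact (Con.eq d).1 (hd _ _ (d.mk' (zel n H ^ i)) (congrArg d.mk' h))
end

section
/- Let n ≥ 5 and M = S_n(Alt_n), with z = a_1⋯a_n. Then for any three distinct indices 1 ≤ i, j, k ≤ n, the equalities a_i a_j a_k z = a_j a_k a_i z and z a_i a_j a_k = z a_j a_k a_i hold in M. -/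
/-- The set of even permutations of `{1,…,n}`. -/
def AltH (n : ℕ) : Set (Equiv.Perm (Fin n)) := ↑(alternatingGroup (Fin n))

/-- The monoid `Sₙ(Altₙ)`. -/
abbrev SAlt (n : ℕ) : Type := Sn n (AltH n)

/-- The generator `aᵢ` of `Sₙ(Altₙ)`. -/
def a (n : ℕ) (i : Fin n) : SAlt n := gen n (AltH n) i

/-- The element `z = a₁⋯aₙ` of `Sₙ(Altₙ)`. -/
def z (n : ℕ) : SAlt n := zel n (AltH n)

/-- The image in `Sₙ(H)` of the word spelled by a list of indices. -/
def wordProd (n : ℕ) (H : Set (Equiv.Perm (Fin n))) (L : List (Fin n)) : Sn n H :=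
  (SnCon n H).mk' (FreeMonoid.ofList L)

theorem wordProd_append (n : ℕ) (H : Set (Equiv.Perm (Fin n))) (L L' : List (Fin n)) :
    wordProd n H (L ++ L') = wordProd n H L * wordProd n H L' := by
  rw [wordProd, FreeMonoid.ofList_append, map_mul]
  rfl

theorem wordProd_triple (n : ℕ) (i j k : Fin n) :
    wordProd n (AltH n) [i, j, k] = a n i * a n j * a n k := by
  have h : [i, j, k] = [i] ++ [j] ++ [k] := rfl
  rw [h, wordProd_append, wordProd_append]
  rfl

theorem wordProd_ofFn_perm {n : ℕ} {H : Set (Equiv.Perm (Fin n))} {σ : Equiv.Perm (Fin n)}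
    (hσ : σ ∈ H) : wordProd n H (List.ofFn σ) = zel n H :=
  ((Con.eq _).2 (ConGen.Rel.of _ _ ⟨σ, hσ, rfl, rfl⟩)).symm

theorem wordProd_ofFn_even {n : ℕ} {σ : Equiv.Perm (Fin n)} (hσ : Equiv.Perm.sign σ = 1) :
    wordProd n (AltH n) (List.ofFn σ) = z n :=
  wordProd_ofFn_perm (Equiv.Perm.mem_alternatingGroup.2 hσ)

theorem List.ofFn_comp_finRotate {α : Type*} {n : ℕ} (f : Fin n → α) :
    List.ofFn (f ∘ finRotate n) = (List.ofFn f).rotate 1 := by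
  cases n with
  | zero => simp
  | succ n =>
    rw [List.ofFn_succ', List.ofFn_succ, List.rotate_cons_succ, List.rotate_zero,
      List.concat_eq_append]
    simp

/-- The word `g₀g₁g₂U` of an even permutation can be rewritten as `U` followed by any
rearrangement of `g₀, g₁, g₂` whose sign compensates that of the rotation by three places. -/
theorem triple_mul_z {n : ℕ} (hn : 5 ≤ n) (g : Fin 3 ↪ Fin n) (e : Equiv.Perm (Fin 3))
    (he : Equiv.Perm.sign e = (-1) ^ (n - 1)) :
    a n (g 0) * a n (g 1) * a n (g 2) * z n =
      z n * (a n (g (e 0)) * a n (g (e 1)) * a n (g (e 2))) := by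
  obtain ⟨m, rfl⟩ : ∃ m, n = m + 3 := ⟨n - 3, by omega⟩
  let c : Fin 3 ↪ Fin (m + 3) := Fin.castLEEmb (by omega)
  obtain ⟨τ, hτ, hτg⟩ : ∃ τ : Equiv.Perm (Fin (m + 3)),
      Equiv.Perm.sign τ = 1 ∧ ∀ i, τ (c i) = g i := by
    have := alternatingGroup.isMultiplyPretransitive (Fin (m + 3))
    have : MulAction.IsMultiplyPretransitive (alternatingGroup (Fin (m + 3))) (Fin (m + 3)) 3 :=
      MulAction.isMultiplyPretransitive_of_le (n := Nat.card (Fin (m + 3)) - 2)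
        (by rw [Nat.card_fin]; omega) (Nat.sub_le _ _)
    obtain ⟨τ, hτ⟩ := MulAction.exists_smul_eq (alternatingGroup (Fin (m + 3))) c g
    exact ⟨τ, Equiv.Perm.mem_alternatingGroup.1 τ.2, fun i => DFunLike.congr_fun hτ i⟩
  let U : List (Fin (m + 3)) := List.ofFn fun i : Fin m => τ i.succ.succ.succ
  have hword (e : Equiv.Perm (Fin 3)) : List.ofFn (τ * e.viaFintypeEmbedding c) =
      [g (e 0), g (e 1), g (e 2)] ++ U := by
    have hc (i : Fin 3) : τ (e.viaFintypeEmbedding c (c i)) = g (e i) := by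
      rw [Equiv.Perm.viaFintypeEmbedding_apply_image, hτg]
    have hU (i : Fin m) : e.viaFintypeEmbedding c i.succ.succ.succ = i.succ.succ.succ := by
      refine Equiv.Perm.viaFintypeEmbedding_apply_notMem_range _ _ ?_
      rintro ⟨j, hj⟩
      have := congrArg Fin.val hj
      simp [c] at this
      omega
    rw [List.ofFn_succ, List.ofFn_succ, List.ofFn_succ]
    simp only [Equiv.Perm.mul_apply, hU]
    rw [← hc 0, ← hc 1, ← hc 2]
    rfl
  have hfront : wordProd (m + 3) (AltH (m + 3)) ([g 0, g 1, g 2] ++ U) = z (m + 3) := by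
    rw [← wordProd_ofFn_even (σ := τ * (1 : Equiv.Perm (Fin 3)).viaFintypeEmbedding c), hword]
    · rfl
    · rw [map_mul, Equiv.Perm.viaFintypeEmbedding_sign, hτ, map_one, one_mul]
  have hback : wordProd (m + 3) (AltH (m + 3)) (U ++ [g (e 0), g (e 1), g (e 2)]) =
      z (m + 3) := by
    rw [← wordProd_ofFn_even
      (σ := τ * e.viaFintypeEmbedding c * finRotate _ * finRotate _ * finRotate _)]
    · simp only [Equiv.Perm.coe_mul (_ * _) (finRotate _), List.ofFn_comp_finRotate, hword]
      simp
    · simp only [map_mul, Equiv.Perm.viaFintypeEmbedding_sign, hτ, he, sign_finRotate]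
      rcases neg_one_pow_eq_or ℤˣ (m + 3 - 1) with h | h <;> simp only [h] <;> rfl
  rw [← wordProd_triple, ← wordProd_triple]
  nth_rewrite 1 [← hback]
  rw [← hfront, ← wordProd_append, ← wordProd_append, List.append_assoc]

/-- in `M = Sₙ(Altₙ)` with `n ≥ 5`, for distinct `i, j, k` one has
`aᵢaⱼaₖz = aⱼaₖaᵢz` and `zaᵢaⱼaₖ = zaⱼaₖaᵢ`. -/
theorem stmt5 (n : ℕ) (hn : 5 ≤ n) (i j k : Fin n)
    (hij : i ≠ j) (hjk : j ≠ k) (hik : i ≠ k) :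
    a n i * a n j * a n k * z n = a n j * a n k * a n i * z n ∧
      z n * (a n i * a n j * a n k) = z n * (a n j * a n k * a n i) := by
  obtain ⟨e, he⟩ := Equiv.Perm.sign_surjective (Fin 3) ((-1) ^ (n - 1))
  have hr : Equiv.Perm.sign (finRotate 3) = 1 := by decide
  let g : Fin 3 ↪ Fin n := ⟨![i, j, k], by
    intro x y h
    fin_cases x <;> fin_cases y <;> simp_all⟩
  let r : Fin 3 ↪ Fin n := (finRotate 3).toEmbedding.trans g
  let s : Fin 3 ↪ Fin n := e.symm.toEmbedding.trans g
  have hg := triple_mul_z hn g e he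
  have hr₁ := triple_mul_z hn r ((finRotate 3)⁻¹ * e) (by simp [he, hr])
  have hs := triple_mul_z hn s e he
  have hs₁ := triple_mul_z hn s (e * finRotate 3) (by simp [he, hr])
  constructor
  · refine hg.trans (Eq.trans ?_ hr₁.symm)
    simp [r]
  · have h := hs.symm.trans hs₁
    simp only [s, Function.Embedding.trans_apply, Equiv.coe_toEmbedding,
      Equiv.Perm.mul_apply, Equiv.symm_apply_apply] at h
    exact h
end

section
/- Let n ≥ 6 be even and M = S_n(Alt_n), with z = a_1⋯a_n. Then for any three distinct indices 1 ≤ i, j, k ≤ n, the equality a_i a_j a_k z = z a_j a_i a_k holds in M. -/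
/-- In `Sₙ(Altₙ)` every even arrangement of the generators has product `z`. -/
theorem prod_ofFn_eq_z (n : ℕ) (σ : Equiv.Perm (Fin n)) (hσ : Equiv.Perm.sign σ = 1) :
    (List.ofFn fun t => a n (σ t)).prod = z n := by
  have h : (SnCon n (AltH n)).mk' (FreeMonoid.ofList (List.ofFn fun t => σ t)) = z n :=
    ((Con.eq _).2 (ConGen.Rel.of _ _ ⟨σ, Equiv.Perm.mem_alternatingGroup.2 hσ, rfl, rfl⟩)).symm
  have hlist : ∀ l : List (Fin n),
      (SnCon n (AltH n)).mk' (FreeMonoid.ofList l) = (l.map (a n)).prod := by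
    intro l
    induction l with
    | nil => exact map_one _
    | cons x l ih => rw [FreeMonoid.ofList_cons, map_mul, ih]; rfl
  rw [← h, hlist, List.map_ofFn]
  rfl

/-- Some even permutation of `Fin (m + 5)` sends `0, 1, 2` to three prescribed distinct values. -/
theorem exists_even_perm_apply_eq (m : ℕ) (i j k : Fin (m + 5))
    (hij : i ≠ j) (hjk : j ≠ k) (hik : i ≠ k) :
    ∃ σ : Equiv.Perm (Fin (m + 5)),
      Equiv.Perm.sign σ = 1 ∧ σ 0 = i ∧ σ 1 = j ∧ σ 2 = k := by
  have hne : ∀ x y : ℕ, x < 5 → y < 5 → x ≠ y → (Fin.ofNat (m + 5) x) ≠ Fin.ofNat (m + 5) y := by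
    intro x y hx hy hxy h
    have := congrArg Fin.val h
    simp only [Fin.val_ofNat] at this
    rw [Nat.mod_eq_of_lt (by omega), Nat.mod_eq_of_lt (by omega)] at this
    exact hxy this
  have h01 : (0 : Fin (m + 5)) ≠ 1 := hne 0 1 (by omega) (by omega) (by omega)
  have h02 : (0 : Fin (m + 5)) ≠ 2 := hne 0 2 (by omega) (by omega) (by omega)
  have h12 : (1 : Fin (m + 5)) ≠ 2 := hne 1 2 (by omega) (by omega) (by omega)
  have h03 : (0 : Fin (m + 5)) ≠ 3 := hne 0 3 (by omega) (by omega) (by omega)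
  have h13 : (1 : Fin (m + 5)) ≠ 3 := hne 1 3 (by omega) (by omega) (by omega)
  have h23 : (2 : Fin (m + 5)) ≠ 3 := hne 2 3 (by omega) (by omega) (by omega)
  have h04 : (0 : Fin (m + 5)) ≠ 4 := hne 0 4 (by omega) (by omega) (by omega)
  have h14 : (1 : Fin (m + 5)) ≠ 4 := hne 1 4 (by omega) (by omega) (by omega)
  have h24 : (2 : Fin (m + 5)) ≠ 4 := hne 2 4 (by omega) (by omega) (by omega)
  have h34 : (3 : Fin (m + 5)) ≠ 4 := hne 3 4 (by omega) (by omega) (by omega)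
  obtain ⟨τ, hτ⟩ := Equiv.Perm.exists_extending_pair ![(0 : Fin (m + 5)), 1, 2] ![i, j, k]
    (by intro x y; fin_cases x <;> fin_cases y <;> simp_all [eq_comm])
    (by intro x y; fin_cases x <;> fin_cases y <;> simp_all [eq_comm])
  have h0 : τ 0 = i := hτ 0
  have h1 : τ 1 = j := hτ 1
  have h2 : τ 2 = k := hτ 2
  rcases Int.units_eq_one_or (Equiv.Perm.sign τ) with h | h
  · exact ⟨τ, h, h0, h1, h2⟩
  · refine ⟨τ * Equiv.swap 3 4, ?_, ?_, ?_, ?_⟩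
    · rw [Equiv.Perm.sign_mul, h, Equiv.Perm.sign_swap h34]; rfl
    · rw [Equiv.Perm.mul_apply, Equiv.swap_apply_of_ne_of_ne h03 h04, h0]
    · rw [Equiv.Perm.mul_apply, Equiv.swap_apply_of_ne_of_ne h13 h14, h1]
    · rw [Equiv.Perm.mul_apply, Equiv.swap_apply_of_ne_of_ne h23 h24, h2]

/-- in `M = Sₙ(Altₙ)` with `n ≥ 6` even, for distinct `i, j, k` one has
`aᵢaⱼaₖz = zaⱼaᵢaₖ`. -/
theorem stmt6 (n : ℕ) (hn : 6 ≤ n) (heven : Even n) (i j k : Fin n)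
    (hij : i ≠ j) (hjk : j ≠ k) (hik : i ≠ k) :
    a n i * a n j * a n k * z n = z n * (a n j * a n i * a n k) := by
  obtain ⟨m, rfl⟩ : ∃ m, n = m + 5 := ⟨n - 5, by omega⟩
  obtain ⟨σ, hσ, rfl, rfl, rfl⟩ := exists_even_perm_apply_eq m i j k hij hjk hik
  have hfront := prod_ofFn_eq_z (m + 5) σ hσ
  let ρ : Equiv.Perm (Fin (m + 5)) := Equiv.swap 0 1 * finRotate (m + 5) ^ 3
  have hback := prod_ofFn_eq_z (m + 5) (σ * ρ) (by
    have h01 : (0 : Fin (m + 5)) ≠ 1 := fun h => hij (congrArg σ h)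
    have hm : Odd (m + 4) := by
      rw [← Nat.not_even_iff_odd]
      exact fun h => (Nat.even_add_one.1 heven) h
    rw [Equiv.Perm.sign_mul, show ρ = _ from rfl, Equiv.Perm.sign_mul, hσ, Equiv.Perm.sign_swap h01, map_pow,
      sign_finRotate, Nat.add_succ_sub_one, hm.neg_one_pow]
    rfl)
  have hrot : ∀ t : Fin (m + 5), (finRotate (m + 5) ^ 3) t = t + 1 + 1 + 1 := by
    intro t
    simp [pow_succ]
  have hshift : ∀ t : Fin (m + 2), ρ (t.castLE (Nat.le_add_right (m + 2) 3)) = t.succ.succ.succ := by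
    intro t
    have h : t.castLE (Nat.le_add_right (m + 2) 3) + 1 + 1 + 1 = t.succ.succ.succ := by
      ext
      simp only [Fin.val_add, Fin.val_castLE, Fin.val_succ, Fin.val_one]
      rw [Nat.mod_eq_of_lt (a := (t : ℕ) + 1) (by omega),
        Nat.mod_eq_of_lt (a := (t : ℕ) + 1 + 1) (by omega), Nat.mod_eq_of_lt (by omega)]
    rw [show ρ = _ from rfl, Equiv.Perm.mul_apply, hrot, h]
    exact Equiv.swap_apply_of_ne_of_ne (Fin.succ_ne_zero _) fun h =>
      Fin.succ_ne_zero _ (Fin.succ_injective _ (h.trans Fin.succ_zero_eq_one.symm))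
  have hend (t s : Fin (m + 5)) (ht : t + 1 + 1 + 1 = s) :
      ρ t = Equiv.swap 0 1 s := by
    rw [show ρ = _ from rfl, Equiv.Perm.mul_apply, hrot, ht]
  have hend0 := hend (Fin.natAdd (m + 2) (0 : Fin 3)) 0 (by ext; simp [Fin.val_add])
  have hend1 := hend (Fin.natAdd (m + 2) (1 : Fin 3)) 1 (by ext; simp [Fin.val_add])
  have hend2 := hend (Fin.natAdd (m + 2) (2 : Fin 3)) 2 (by ext; simp [Fin.val_add])
  rw [Equiv.swap_apply_left] at hend0
  rw [Equiv.swap_apply_right] at hend1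
  rw [Equiv.swap_apply_of_ne_of_ne (fun h => hik (congrArg σ h.symm))
    (fun h => hjk (congrArg σ h.symm))] at hend2
  have e1 : (0 : Fin (m + 4)).succ = 1 := rfl
  have e2 : (0 : Fin (m + 3)).succ.succ = 2 := rfl
  rw [List.ofFn_succ, List.ofFn_succ, List.ofFn_succ, e1, e2] at hfront
  rw [List.ofFn_add (n := m + 2) (m := 3), List.prod_append] at hback
  simp only [Equiv.Perm.mul_apply σ, hshift] at hback
  rw [List.ofFn_succ (n := 2), List.ofFn_succ (n := 1), List.ofFn_succ (n := 0), List.ofFn_zero] at hback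
  simp only [Fin.succ_zero_eq_one, Fin.succ_one_eq_two, hend0, hend1, hend2] at hback
  simp only [List.prod_cons, List.prod_nil, mul_one] at hfront hback
  conv_lhs => rw [← hback]
  rw [← hfront]
  simp only [mul_assoc]
end

section
/- Let n ≥ 4 and M = S_n(Alt_n), with z = a_1⋯a_n. Then for all 1 ≤ i, j ≤ n, the equalities a_i^2 a_j z^2 = a_j a_i^2 z^2 and a_i a_j a_i a_j z^2 = a_j a_i a_j a_i z^2 hold in M. -/
/-- A word `w'` arises from `w` by moving one letter to the right past its next two neighbours. -/
inductive AdjacentRotation {α : Type*} : List α → List α → Prop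
  | mk (u v : List α) (a b c : α) :
      AdjacentRotation (u ++ a :: b :: c :: v) (u ++ b :: c :: a :: v)

/-- A word `w'` arises from `w` by finitely many rotations of three adjacent letters. -/
abbrev EvenRearrangement {α : Type*} : List α → List α → Prop :=
  Relation.ReflTransGen AdjacentRotation

/-- The value of a word under an assignment of the letters to elements of a monoid. -/
def word {α M : Type*} [Monoid M] (x : α → M) (w : List α) : M :=
  (w.map x).prod

theorem word_append {α M : Type*} [Monoid M] (x : α → M) (u v : List α) :
    word x (u ++ v) = word x u * word x v := by
  simp [word]

theorem word_flatMap {α β M : Type*} [Monoid M] (x : β → M) (X : α → List β) (w : List α) :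
    word x (w.flatMap X) = word (fun i => word x (X i)) w := by
  induction w with
  | nil => rfl
  | cons i w ih => simp_all [word]

theorem word_replace {α M : Type*} [Monoid M] {x : α → M} {Z : M} (u p q v : List α)
    (hp : word x p = Z) (hq : word x q = Z) :
    word x (u ++ p ++ v) = word x (u ++ q ++ v) := by
  simp only [word_append, hp, hq]

theorem word_remove {α M : Type*} [Monoid M] {x : α → M} {Z : M}
    (hZ : ∀ i, Commute Z (x i)) (u p v : List α) (hp : word x p = Z) :
    word x (u ++ p ++ v) = word x (u ++ v) * Z := by
  have hv : Commute Z (word x v) := by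
    induction v with
    | nil => exact Commute.one_right Z
    | cons i v ih => simpa [word] using (hZ i).mul_right ih
  rw [word_append, word_append, word_append, hp, mul_assoc, hv.eq, mul_assoc]

theorem word_remove_mul {α M : Type*} [Monoid M] {x : α → M} {Z : M}
    (hZ : ∀ i, Commute Z (x i)) (u p v : List α) (hp : word x p = Z) :
    word x (u ++ p ++ v) * Z = word x (u ++ v) * Z ^ 2 := by
  rw [word_remove hZ u p v hp, mul_assoc, sq]

theorem commute_of_five {α M : Type*} [Monoid M] {x : α → M} {Z : M} {i j k l m : α}
    (h : ∀ w, EvenRearrangement [i, j, k, l, m] w → word x w = Z) :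
    ∀ r ∈ [i, j, k, l, m], Commute Z (x r) := by
  have aux (r a b c d : α) (hw : EvenRearrangement [i, j, k, l, m] [r, a, b, c, d]) :
      Commute Z (x r) := by
    have h1 := h _ hw
    have h2 := h _ ((hw.tail (.mk [] [c, d] r a b)).tail (.mk [a, b] [] r c d))
    simp only [word, List.map_cons, List.map_nil, List.nil_append,
      List.cons_append, List.prod_cons, List.prod_nil, mul_one] at h1 h2
    calc Z * x r = x r * (x a * (x b * (x c * x d))) * x r := by rw [h1]
      _ = x r * (x a * (x b * (x c * (x d * x r)))) := by simp only [mul_assoc]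
      _ = x r * Z := by rw [h2]
  have e01234 : EvenRearrangement [i, j, k, l, m] [i, j, k, l, m] := .refl
  have e12034 : EvenRearrangement [i, j, k, l, m] [j, k, i, l, m] :=
    e01234.tail (.mk [] [l, m] i j k)
  have e12340 : EvenRearrangement [i, j, k, l, m] [j, k, l, m, i] :=
    e12034.tail (.mk [j, k] [] i l m)
  have e20134 : EvenRearrangement [i, j, k, l, m] [k, i, j, l, m] :=
    e12034.tail (.mk [] [l, m] j k i)
  have e20341 : EvenRearrangement [i, j, k, l, m] [k, i, l, m, j] :=
    e20134.tail (.mk [k, i] [] j l m)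
  have e23401 : EvenRearrangement [i, j, k, l, m] [k, l, m, i, j] :=
    e20341.tail (.mk [k] [j] i l m)
  have e01342 : EvenRearrangement [i, j, k, l, m] [i, j, l, m, k] :=
    e01234.tail (.mk [i, j] [] k l m)
  have e03412 : EvenRearrangement [i, j, k, l, m] [i, l, m, j, k] :=
    e01342.tail (.mk [i] [k] j l m)
  have e34012 : EvenRearrangement [i, j, k, l, m] [l, m, i, j, k] :=
    e03412.tail (.mk [] [j, k] i l m)
  have e01423 : EvenRearrangement [i, j, k, l, m] [i, j, m, k, l] :=
    e01342.tail (.mk [i, j] [] l m k)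
  have e14023 : EvenRearrangement [i, j, k, l, m] [j, m, i, k, l] :=
    e01423.tail (.mk [] [k, l] i j m)
  have e40123 : EvenRearrangement [i, j, k, l, m] [m, i, j, k, l] :=
    e14023.tail (.mk [] [k, l] j m i)
  simp only [List.forall_mem_cons, List.not_mem_nil, IsEmpty.forall_iff, implies_true, and_true]
  exact ⟨aux _ _ _ _ _ e01234,
    aux _ _ _ _ _ e12340,
    aux _ _ _ _ _ e23401,
    aux _ _ _ _ _ e34012,
    aux _ _ _ _ _ e40123⟩

theorem word_sq_of_four {α M : Type*} [Monoid M] {x : α → M} {Z : M} {i j k l : α}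
    (h : ∀ w, EvenRearrangement [i, j, k, l] w → word x w = Z) :
    word x [i, i, j] * Z ^ 2 = word x [j, i, i] * Z ^ 2 := by
  have e0123 : EvenRearrangement [i, j, k, l] [i, j, k, l] := .refl
  have e0231 : EvenRearrangement [i, j, k, l] [i, k, l, j] :=
    e0123.tail (.mk [i] [] j k l)
  have e2301 : EvenRearrangement [i, j, k, l] [k, l, i, j] :=
    e0231.tail (.mk [] [j] i k l)
  have e1203 : EvenRearrangement [i, j, k, l] [j, k, i, l] :=
    e0123.tail (.mk [] [l] i j k)
  have e0312 : EvenRearrangement [i, j, k, l] [i, l, j, k] :=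
    e0231.tail (.mk [i] [] k l j)
  have e3102 : EvenRearrangement [i, j, k, l] [l, j, i, k] :=
    e0312.tail (.mk [] [k] i l j)
  have e1032 : EvenRearrangement [i, j, k, l] [j, i, l, k] :=
    e1203.tail (.mk [j] [] k i l)
  have e1320 : EvenRearrangement [i, j, k, l] [j, l, k, i] :=
    e1032.tail (.mk [j] [] i l k)
  have e3210 : EvenRearrangement [i, j, k, l] [l, k, j, i] :=
    e1320.tail (.mk [] [i] j l k)
  rw [sq, ← h _ e0123, ← mul_assoc, ← mul_assoc]
  simp only [← word_append, List.cons_append, List.nil_append]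
  calc
    word x [i, i, j, i, j, k, l, i, j, k, l] = word x [i, i, j, k, l, i, j, i, j, k, l] :=
      word_replace [i, i, j] [i, j, k, l] [k, l, i, j] [i, j, k, l] (h _ e0123) (h _ e2301)
    _ = word x [i, j, k, i, l, i, j, i, j, k, l] :=
      word_replace [i] [i, j, k, l] [j, k, i, l] [i, j, i, j, k, l] (h _ e0123) (h _ e1203)
    _ = word x [i, j, k, i, l, i, j, k, l, i, j] :=
      word_replace [i, j, k, i, l, i, j] [i, j, k, l] [k, l, i, j] [] (h _ e0123) (h _ e2301)
    _ = word x [i, j, k, i, l, j, k, i, l, i, j] :=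
      word_replace [i, j, k, i, l] [i, j, k, l] [j, k, i, l] [i, j] (h _ e0123) (h _ e1203)
    _ = word x [i, j, k, l, j, i, k, i, l, i, j] :=
      word_replace [i, j, k] [i, l, j, k] [l, j, i, k] [i, l, i, j] (h _ e0312) (h _ e3102)
    _ = word x [j, i, l, k, j, i, k, i, l, i, j] :=
      word_replace [] [i, j, k, l] [j, i, l, k] [j, i, k, i, l, i, j] (h _ e0123) (h _ e1032)
    _ = word x [j, i, i, k, l, j, k, i, l, i, j] :=
      word_replace [j, i] [l, k, j, i] [i, k, l, j] [k, i, l, i, j] (h _ e3210) (h _ e0231)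
    _ = word x [j, i, i, k, l, i, j, k, l, i, j] :=
      word_replace [j, i, i, k, l] [j, k, i, l] [i, j, k, l] [i, j] (h _ e1203) (h _ e0123)
    _ = word x [j, i, i, i, j, k, l, k, l, i, j] :=
      word_replace [j, i, i] [k, l, i, j] [i, j, k, l] [k, l, i, j] (h _ e2301) (h _ e0123)
    _ = word x [j, i, i, i, j, k, l, i, j, k, l] :=
      word_replace [j, i, i, i, j, k, l] [k, l, i, j] [i, j, k, l] [] (h _ e2301) (h _ e0123)

theorem word_alternating_of_four {α M : Type*} [Monoid M] {x : α → M} {Z : M} {i j k l : α}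
    (h : ∀ w, EvenRearrangement [i, j, k, l] w → word x w = Z) :
    word x [i, j, i, j] * Z ^ 2 = word x [j, i, j, i] * Z ^ 2 := by
  have e0123 : EvenRearrangement [i, j, k, l] [i, j, k, l] := .refl
  have e0231 : EvenRearrangement [i, j, k, l] [i, k, l, j] :=
    e0123.tail (.mk [i] [] j k l)
  have e2301 : EvenRearrangement [i, j, k, l] [k, l, i, j] :=
    e0231.tail (.mk [] [j] i k l)
  have e1203 : EvenRearrangement [i, j, k, l] [j, k, i, l] :=
    e0123.tail (.mk [] [l] i j k)
  have e1032 : EvenRearrangement [i, j, k, l] [j, i, l, k] :=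
    e1203.tail (.mk [j] [] k i l)
  have e3021 : EvenRearrangement [i, j, k, l] [l, i, k, j] :=
    e2301.tail (.mk [] [j] k l i)
  have e2013 : EvenRearrangement [i, j, k, l] [k, i, j, l] :=
    e1203.tail (.mk [] [l] j k i)
  have e0312 : EvenRearrangement [i, j, k, l] [i, l, j, k] :=
    e0231.tail (.mk [i] [] k l j)
  rw [sq, ← h _ e0123, ← mul_assoc, ← mul_assoc]
  simp only [← word_append, List.cons_append, List.nil_append]
  calc
    word x [i, j, i, j, i, j, k, l, i, j, k, l] = word x [i, j, i, j, k, l, i, j, i, j, k, l] :=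
      word_replace [i, j, i, j] [i, j, k, l] [k, l, i, j] [i, j, k, l] (h _ e0123) (h _ e2301)
    _ = word x [i, j, k, l, i, j, i, j, i, j, k, l] :=
      word_replace [i, j] [i, j, k, l] [k, l, i, j] [i, j, i, j, k, l] (h _ e0123) (h _ e2301)
    _ = word x [j, i, l, k, i, j, i, j, i, j, k, l] :=
      word_replace [] [i, j, k, l] [j, i, l, k] [i, j, i, j, i, j, k, l] (h _ e0123) (h _ e1032)
    _ = word x [j, i, l, k, i, j, i, j, k, l, i, j] :=
      word_replace [j, i, l, k, i, j, i, j] [i, j, k, l] [k, l, i, j] [] (h _ e0123) (h _ e2301)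
    _ = word x [j, i, l, k, i, j, l, i, k, j, i, j] :=
      word_replace [j, i, l, k, i, j] [i, j, k, l] [l, i, k, j] [i, j] (h _ e0123) (h _ e3021)
    _ = word x [j, i, l, j, k, i, l, i, k, j, i, j] :=
      word_replace [j, i, l] [k, i, j, l] [j, k, i, l] [i, k, j, i, j] (h _ e2013) (h _ e1203)
    _ = word x [j, i, j, k, l, i, l, i, k, j, i, j] :=
      word_replace [j] [i, l, j, k] [i, j, k, l] [i, l, i, k, j, i, j] (h _ e0312) (h _ e0123)
    _ = word x [j, i, j, k, l, i, j, i, l, k, i, j] :=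
      word_replace [j, i, j, k, l, i] [l, i, k, j] [j, i, l, k] [i, j] (h _ e3021) (h _ e1032)
    _ = word x [j, i, j, i, k, l, j, i, l, k, i, j] :=
      word_replace [j, i, j] [k, l, i, j] [i, k, l, j] [i, l, k, i, j] (h _ e2301) (h _ e0231)
    _ = word x [j, i, j, i, k, l, i, j, k, l, i, j] :=
      word_replace [j, i, j, i, k, l] [j, i, l, k] [i, j, k, l] [i, j] (h _ e1032) (h _ e0123)
    _ = word x [j, i, j, i, i, j, k, l, k, l, i, j] :=
      word_replace [j, i, j, i] [k, l, i, j] [i, j, k, l] [k, l, i, j] (h _ e2301) (h _ e0123)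
    _ = word x [j, i, j, i, i, j, k, l, i, j, k, l] :=
      word_replace [j, i, j, i, i, j, k, l] [k, l, i, j] [i, j, k, l] [] (h _ e2301) (h _ e0123)

theorem word_sq_of_five {α M : Type*} [Monoid M] {x : α → M} {Z : M} {i j k l m : α}
    (h : ∀ w, EvenRearrangement [i, j, k, l, m] w → word x w = Z)
    (hZ : ∀ i, Commute Z (x i)) :
    word x [i, i, j] * Z ^ 2 = word x [j, i, i] * Z ^ 2 := by
  have e01234 : EvenRearrangement [i, j, k, l, m] [i, j, k, l, m] := .refl
  have e12034 : EvenRearrangement [i, j, k, l, m] [j, k, i, l, m] :=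
    e01234.tail (.mk [] [l, m] i j k)
  have e10324 : EvenRearrangement [i, j, k, l, m] [j, i, l, k, m] :=
    e12034.tail (.mk [j] [m] k i l)
  have e10243 : EvenRearrangement [i, j, k, l, m] [j, i, k, m, l] :=
    e10324.tail (.mk [j, i] [] l k m)
  have e02314 : EvenRearrangement [i, j, k, l, m] [i, k, l, j, m] :=
    e01234.tail (.mk [i] [m] j k l)
  have e02143 : EvenRearrangement [i, j, k, l, m] [i, k, j, m, l] :=
    e02314.tail (.mk [i, k] [] l j m)
  have e02431 : EvenRearrangement [i, j, k, l, m] [i, k, m, l, j] :=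
    e02143.tail (.mk [i, k] [] j m l)
  have e04321 : EvenRearrangement [i, j, k, l, m] [i, m, l, k, j] :=
    e02431.tail (.mk [i] [j] k m l)
  have e12340 : EvenRearrangement [i, j, k, l, m] [j, k, l, m, i] :=
    e12034.tail (.mk [j, k] [] i l m)
  have e23140 : EvenRearrangement [i, j, k, l, m] [k, l, j, m, i] :=
    e12340.tail (.mk [] [m, i] j k l)
  have e21430 : EvenRearrangement [i, j, k, l, m] [k, j, m, l, i] :=
    e23140.tail (.mk [k] [i] l j m)
  have e01342 : EvenRearrangement [i, j, k, l, m] [i, j, l, m, k] :=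
    e01234.tail (.mk [i, j] [] k l m)
  have e01423 : EvenRearrangement [i, j, k, l, m] [i, j, m, k, l] :=
    e01342.tail (.mk [i, j] [] l m k)
  have e04213 : EvenRearrangement [i, j, k, l, m] [i, m, k, j, l] :=
    e01423.tail (.mk [i] [l] j m k)
  have e13204 : EvenRearrangement [i, j, k, l, m] [j, l, k, i, m] :=
    e10324.tail (.mk [j] [m] i l k)
  have e20134 : EvenRearrangement [i, j, k, l, m] [k, i, j, l, m] :=
    e12034.tail (.mk [] [l, m] j k i)
  have e20341 : EvenRearrangement [i, j, k, l, m] [k, i, l, m, j] :=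
    e20134.tail (.mk [k, i] [] j l m)
  have e23401 : EvenRearrangement [i, j, k, l, m] [k, l, m, i, j] :=
    e20341.tail (.mk [k] [j] i l m)
  have e34201 : EvenRearrangement [i, j, k, l, m] [l, m, k, i, j] :=
    e23401.tail (.mk [] [i, j] k l m)
  have e42301 : EvenRearrangement [i, j, k, l, m] [m, k, l, i, j] :=
    e34201.tail (.mk [] [i, j] l m k)
  calc
    word x [i, i, j] * Z ^ 2 = word x [j, i, k, m, l, i, i, j] * Z :=
      (word_remove_mul hZ [] [j, i, k, m, l] [i, i, j] (h _ e10243)).symm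
    _ = word x [j, i, k, i, m, l, k, j, m, l, i, i, j] :=
      (word_remove hZ [j, i, k] [i, m, l, k, j] [m, l, i, i, j] (h _ e04321)).symm
    _ = word x [j, i, k, i, m, l, i, j] * Z :=
      word_remove hZ [j, i, k, i, m, l] [k, j, m, l, i] [i, j] (h _ e21430)
    _ = word x [j, i, i, m, k, j, l, k, i, m, l, i, j] :=
      (word_remove hZ [j, i] [i, m, k, j, l] [k, i, m, l, i, j] (h _ e04213)).symm
    _ = word x [j, i, i, m, k, l, i, j] * Z :=
      word_remove hZ [j, i, i, m, k] [j, l, k, i, m] [l, i, j] (h _ e13204)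
    _ = word x [j, i, i] * Z ^ 2 :=
      word_remove_mul hZ [j, i, i] [m, k, l, i, j] [] (h _ e42301)

theorem word_alternating_of_five {α M : Type*} [Monoid M] {x : α → M} {Z : M} {i j k l m : α}
    (h : ∀ w, EvenRearrangement [i, j, k, l, m] w → word x w = Z)
    (hZ : ∀ i, Commute Z (x i)) :
    word x [i, j, i, j] * Z ^ 2 = word x [j, i, j, i] * Z ^ 2 := by
  have e01234 : EvenRearrangement [i, j, k, l, m] [i, j, k, l, m] := .refl
  have e12034 : EvenRearrangement [i, j, k, l, m] [j, k, i, l, m] :=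
    e01234.tail (.mk [] [l, m] i j k)
  have e10324 : EvenRearrangement [i, j, k, l, m] [j, i, l, k, m] :=
    e12034.tail (.mk [j] [m] k i l)
  have e10243 : EvenRearrangement [i, j, k, l, m] [j, i, k, m, l] :=
    e10324.tail (.mk [j, i] [] l k m)
  have e02314 : EvenRearrangement [i, j, k, l, m] [i, k, l, j, m] :=
    e01234.tail (.mk [i] [m] j k l)
  have e02143 : EvenRearrangement [i, j, k, l, m] [i, k, j, m, l] :=
    e02314.tail (.mk [i, k] [] l j m)
  have e02431 : EvenRearrangement [i, j, k, l, m] [i, k, m, l, j] :=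
    e02143.tail (.mk [i, k] [] j m l)
  have e04321 : EvenRearrangement [i, j, k, l, m] [i, m, l, k, j] :=
    e02431.tail (.mk [i] [j] k m l)
  have e12340 : EvenRearrangement [i, j, k, l, m] [j, k, l, m, i] :=
    e12034.tail (.mk [j, k] [] i l m)
  have e23140 : EvenRearrangement [i, j, k, l, m] [k, l, j, m, i] :=
    e12340.tail (.mk [] [m, i] j k l)
  have e21430 : EvenRearrangement [i, j, k, l, m] [k, j, m, l, i] :=
    e23140.tail (.mk [k] [i] l j m)
  have e01342 : EvenRearrangement [i, j, k, l, m] [i, j, l, m, k] :=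
    e01234.tail (.mk [i, j] [] k l m)
  have e13042 : EvenRearrangement [i, j, k, l, m] [j, l, i, m, k] :=
    e01342.tail (.mk [] [m, k] i j l)
  have e24310 : EvenRearrangement [i, j, k, l, m] [k, m, l, j, i] :=
    e21430.tail (.mk [k] [i] j m l)
  have e01423 : EvenRearrangement [i, j, k, l, m] [i, j, m, k, l] :=
    e01342.tail (.mk [i, j] [] l m k)
  have e04213 : EvenRearrangement [i, j, k, l, m] [i, m, k, j, l] :=
    e01423.tail (.mk [i] [l] j m k)
  have e42013 : EvenRearrangement [i, j, k, l, m] [m, k, i, j, l] :=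
    e04213.tail (.mk [] [j, l] i m k)
  have e03124 : EvenRearrangement [i, j, k, l, m] [i, l, j, k, m] :=
    e02314.tail (.mk [i] [m] k l j)
  have e03241 : EvenRearrangement [i, j, k, l, m] [i, l, k, m, j] :=
    e03124.tail (.mk [i, l] [] j k m)
  have e32041 : EvenRearrangement [i, j, k, l, m] [l, k, i, m, j] :=
    e03241.tail (.mk [] [m, j] i l k)
  calc
    word x [i, j, i, j] * Z ^ 2 = word x [j, i, k, m, l, i, j, i, j] * Z :=
      (word_remove_mul hZ [] [j, i, k, m, l] [i, j, i, j] (h _ e10243)).symm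
    _ = word x [j, i, k, i, m, l, k, j, m, l, i, j, i, j] :=
      (word_remove hZ [j, i, k] [i, m, l, k, j] [m, l, i, j, i, j] (h _ e04321)).symm
    _ = word x [j, i, k, i, m, l, j, i, j] * Z :=
      word_remove hZ [j, i, k, i, m, l] [k, j, m, l, i] [j, i, j] (h _ e21430)
    _ = word x [j, i, k, i, j, l, i, m, k, m, l, j, i, j] :=
      (word_remove hZ [j, i, k, i] [j, l, i, m, k] [m, l, j, i, j] (h _ e13042)).symm
    _ = word x [j, i, k, i, j, l, i, m, j] * Z :=
      word_remove hZ [j, i, k, i, j, l, i, m] [k, m, l, j, i] [j] (h _ e24310)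
    _ = word x [j, i, j, i, l, k, m, k, i, j, l, i, m, j] :=
      (word_remove hZ [j, i] [j, i, l, k, m] [k, i, j, l, i, m, j] (h _ e10324)).symm
    _ = word x [j, i, j, i, l, k, i, m, j] * Z :=
      word_remove hZ [j, i, j, i, l, k] [m, k, i, j, l] [i, m, j] (h _ e42013)
    _ = word x [j, i, j, i] * Z ^ 2 :=
      word_remove_mul hZ [j, i, j, i] [l, k, i, m, j] [] (h _ e32041)

theorem EvenRearrangement.move_past {α : Type*} (u v : List α) (a : α) :
    ∀ L : List α, Even L.length → EvenRearrangement (u ++ a :: (L ++ v)) (u ++ L ++ a :: v)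
  | [], _ => by simpa using Relation.ReflTransGen.refl
  | [_], h => by simp at h
  | b :: c :: L, h => by
    have hL : Even L.length := by
      simpa [Nat.even_add_one] using h
    have key := move_past (u ++ [b, c]) v a L hL
    have first : AdjacentRotation (u ++ a :: (b :: c :: L ++ v)) (u ++ b :: c :: a :: (L ++ v)) :=
      .mk u (L ++ v) a b c
    exact Relation.ReflTransGen.head first (by simpa using key)

theorem EvenRearrangement.move_block_past {α : Type*} (A : List α) :
    ∀ u v L : List α, Even L.length →
      EvenRearrangement (u ++ A ++ L ++ v) (u ++ L ++ A ++ v) := by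
  induction A with
  | nil => intro u v L _; simpa using Relation.ReflTransGen.refl
  | cons a A ih =>
    intro u v L hL
    have h1 := ih (u ++ [a]) v L hL
    have h2 := move_past u (A ++ v) a L hL
    simp only [List.append_assoc, List.cons_append, List.nil_append] at h1 h2 ⊢
    exact h1.trans h2

/-- Substituting words of odd length for the letters preserves even rearrangements. -/
theorem EvenRearrangement.flatMap {α β : Type*} {X : α → List β} (hX : ∀ i, Odd (X i).length)
    {w w' : List α} (h : EvenRearrangement w w') :
    EvenRearrangement (w.flatMap X) (w'.flatMap X) := by
  induction h with
  | refl => exact .refl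
  | tail _ hr ih =>
    obtain ⟨u, v, a, b, c⟩ := hr
    refine ih.trans ?_
    have key := move_block_past (X a) (u.flatMap X) (v.flatMap X) (X b ++ X c)
      (by simpa using (hX b).add_odd (hX c))
    simpa using key

theorem AdjacentRotation.exists_even_ofFn {n : ℕ} {w w' : List (Fin n)}
    (h : AdjacentRotation w w') (hw : ∃ σ ∈ AltH n, w = List.ofFn σ) :
    ∃ σ ∈ AltH n, w' = List.ofFn σ := by
  obtain ⟨u, v, a, b, c⟩ := h
  obtain ⟨σ, hσ, hw⟩ := hw
  have hnd : (u ++ a :: b :: c :: v).Nodup := hw ▸ List.nodup_ofFn.2 σ.injective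
  have hab : a ≠ b := by rintro rfl; simp [List.nodup_append] at hnd
  have hac : a ≠ c := by rintro rfl; simp [List.nodup_append] at hnd
  have hbc : b ≠ c := by rintro rfl; simp [List.nodup_append] at hnd
  have hfix (l : List (Fin n)) (ha : a ∉ l) (hb : b ∉ l) (hc : c ∉ l) :
      l.map (Equiv.swap a b * Equiv.swap b c) = l := by
    refine (List.map_congr_left fun i hi => ?_).trans l.map_id
    have hia : i ≠ a := fun e => ha (e ▸ hi)
    have hib : i ≠ b := fun e => hb (e ▸ hi)
    have hic : i ≠ c := fun e => hc (e ▸ hi)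
    simp [Equiv.swap_apply_of_ne_of_ne, hia, hib, hic]
  refine ⟨Equiv.swap a b * Equiv.swap b c * σ, ?_, ?_⟩
  · have hσ' : Equiv.Perm.sign σ = 1 := hσ
    change Equiv.Perm.sign _ = 1
    simp [hab, hbc, hσ']
  · have hmap : List.ofFn (Equiv.swap a b * Equiv.swap b c * σ) =
        (List.ofFn σ).map (Equiv.swap a b * Equiv.swap b c) := by
      rw [List.map_ofFn]; rfl
    have hu := hfix u (by grind) (by grind) (by grind)
    have hv := hfix v (by grind) (by grind) (by grind)
    rw [hmap, ← hw]
    simp only [List.map_append, List.map_cons, hu, hv]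
    simp [Equiv.swap_apply_of_ne_of_ne, hab, hac, hac.symm, hbc.symm]

theorem word_a {n : ℕ} (w : List (Fin n)) :
    word (a n) w = (SnCon n (AltH n)).mk' (FreeMonoid.ofList w) := by
  induction w with
  | nil => rfl
  | cons i w ih =>
    rw [FreeMonoid.ofList_cons, map_mul, ← ih]
    simp [word, a, gen]

theorem word_ofFn_eq_z {n : ℕ} {σ : Equiv.Perm (Fin n)} (hσ : σ ∈ AltH n) :
    word (a n) (List.ofFn σ) = z n := by
  rw [word_a]
  exact ((Con.eq _).2 (ConGen.Rel.of _ _ ⟨σ, hσ, rfl, rfl⟩)).symm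

theorem word_eq_z_of_evenRearrangement {n : ℕ} {w w' : List (Fin n)}
    (hw : ∃ σ ∈ AltH n, w = List.ofFn σ) (h : EvenRearrangement w w') :
    word (a n) w' = z n := by
  have hw' : ∃ σ ∈ AltH n, w' = List.ofFn σ := by
    induction h with
    | refl => exact hw
    | tail _ hr ih => exact hr.exists_even_ofFn ih
  obtain ⟨σ, hσ, rfl⟩ := hw'
  exact word_ofFn_eq_z hσ

theorem exists_even_ofFn_eq_cons_cons {m : ℕ} {i j : Fin (m + 4)} (hij : i ≠ j) :
    ∃ (c d : Fin (m + 4)) (D : List (Fin (m + 4))), D.length = m ∧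
      ∃ σ ∈ AltH (m + 4), i :: j :: c :: d :: D = List.ofFn σ := by
  obtain ⟨σ, hσ, h0, h1⟩ : ∃ σ : Equiv.Perm (Fin (m + 4)), σ ∈ AltH (m + 4) ∧
      σ 0 = i ∧ σ 1 = j := by
    obtain ⟨τ, h0, h1⟩ : ∃ τ : Equiv.Perm (Fin (m + 4)), τ 0 = i ∧ τ 1 = j := by
      have hne : i ≠ Equiv.swap 0 i 1 := fun e => by
        have := (Equiv.swap (0 : Fin (m + 4)) i).injective
          ((Equiv.swap_apply_left 0 i).trans e)
        simp at this
      exact ⟨Equiv.swap (Equiv.swap 0 i 1) j * Equiv.swap 0 i,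
        by simp [Equiv.swap_apply_of_ne_of_ne hne hij], by simp⟩
    rcases Int.units_eq_one_or (Equiv.Perm.sign τ) with hτ | hτ
    · exact ⟨τ, hτ, h0, h1⟩
    · let p : Fin (m + 4) := ⟨2, by lia⟩
      let q : Fin (m + 4) := ⟨3, by lia⟩
      have h0p : 0 ≠ p := by simp [p, Fin.ext_iff]
      have h0q : 0 ≠ q := by simp [q, Fin.ext_iff]
      have h1p : 1 ≠ p := by simp [p, Fin.ext_iff]
      have h1q : 1 ≠ q := by simp [q, Fin.ext_iff]
      have hpq : p ≠ q := by simp [p, q]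
      refine ⟨τ * Equiv.swap p q, ?_, ?_, ?_⟩
      · change Equiv.Perm.sign _ = 1
        simp [Equiv.Perm.sign_swap hpq, hτ]
      · simp [Equiv.swap_apply_of_ne_of_ne h0p h0q, h0]
      · simp [Equiv.swap_apply_of_ne_of_ne h1p h1q, h1]
  refine ⟨σ 2, σ 3, List.ofFn fun k : Fin m => σ k.succ.succ.succ.succ, by simp, σ, hσ, ?_⟩
  subst h0 h1
  simp only [List.ofFn_succ]
  rfl

/-- in `M = Sₙ(Altₙ)` with `n ≥ 4`, for all `i, j` one has
`aᵢ²aⱼz² = aⱼaᵢ²z²` and `aᵢaⱼaᵢaⱼz² = aⱼaᵢaⱼaᵢz²`. -/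
theorem stmt9 (n : ℕ) (hn : 4 ≤ n) (i j : Fin n) :
    a n i ^ 2 * a n j * (z n) ^ 2 = a n j * a n i ^ 2 * (z n) ^ 2 ∧
      a n i * a n j * a n i * a n j * (z n) ^ 2 =
        a n j * a n i * a n j * a n i * (z n) ^ 2 := by
  rcases eq_or_ne i j with rfl | hij
  · exact ⟨by rw [← pow_succ, ← pow_succ'], rfl⟩
  obtain ⟨m, rfl⟩ := Nat.exists_eq_add_of_le' hn
  obtain ⟨c, d, D, hD, hw⟩ := exists_even_ofFn_eq_cons_cons hij
  rcases Nat.even_or_odd m with hm | hm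
  · let X : Fin 4 → List (Fin (m + 4)) := ![[i], [j], [c], d :: D]
    have hX (k : Fin 4) : Odd (X k).length := by
      fin_cases k <;> simp [X, hD, hm.add_one]
    have h (w : List (Fin 4)) (hr : EvenRearrangement [0, 1, 2, 3] w) :
        word (fun k => word (a (m + 4)) (X k)) w = z (m + 4) := by
      rw [← word_flatMap]
      exact word_eq_z_of_evenRearrangement (by simpa [X] using hw) (hr.flatMap hX)
    have h1 := word_sq_of_four h
    have h2 := word_alternating_of_four h
    simp only [word, X, List.map_cons, List.map_nil, List.prod_cons, List.prod_nil, mul_one,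
      Matrix.cons_val_zero, Matrix.cons_val_one] at h1 h2
    exact ⟨by simpa only [sq (a _ _), mul_assoc] using h1,
      by simpa only [mul_assoc] using h2⟩
  · let X : Fin 5 → List (Fin (m + 4)) := ![[i], [j], [c], [d], D]
    have hX (k : Fin 5) : Odd (X k).length := by
      fin_cases k <;> simp [X, hD, hm]
    have h (w : List (Fin 5)) (hr : EvenRearrangement [0, 1, 2, 3, 4] w) :
        word (fun k => word (a (m + 4)) (X k)) w = z (m + 4) := by
      rw [← word_flatMap]
      exact word_eq_z_of_evenRearrangement (by simpa [X] using hw) (hr.flatMap hX)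
    have hZ (k : Fin 5) : Commute (z (m + 4)) (word (a (m + 4)) (X k)) :=
      commute_of_five h k (by fin_cases k <;> simp)
    have h1 := word_sq_of_five h hZ
    have h2 := word_alternating_of_five h hZ
    simp only [word, X, List.map_cons, List.map_nil, List.prod_cons, List.prod_nil, mul_one,
      Matrix.cons_val_zero, Matrix.cons_val_one] at h1 h2
    exact ⟨by simpa only [sq (a _ _), mul_assoc] using h1,
      by simpa only [mul_assoc] using h2⟩
end

section
/- Let n ≥ 6 be even, M = S_n(Alt_n), z = a_1⋯a_n, and let k, l, r be three distinct indices in {1,...,n}. Then (a_k a_l a_r z) a_i = a_i (a_k a_l a_r z) for every i ∉ {k, l, r}, and (a_k a_l a_r z) a_i = a_i (a_l a_k a_r z) for every i ∈ {k, l, r}. -/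
/-- `IsArrangement n s w` says that `w` lists the letters `1,…,n` in an order of sign `s`. -/
def IsArrangement (n : ℕ) (s : ℤˣ) (w : List (Fin n)) : Prop :=
  ∃ σ : Equiv.Perm (Fin n), Equiv.Perm.sign σ = s ∧ w = List.ofFn σ

/-- The value in `Sₙ(Altₙ)` of a word in the generators. -/
def evalWord (n : ℕ) (w : List (Fin n)) : SAlt n := (w.map (a n)).prod

theorem mk_ofList_eq_evalWord (n : ℕ) (w : List (Fin n)) :
    (SnCon n (AltH n)).mk' (FreeMonoid.ofList w) = evalWord n w := by
  induction w with
  | nil => exact map_one _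
  | cons x w ih =>
    rw [FreeMonoid.ofList_cons, map_mul, ih]
    simp [evalWord, a, gen]

theorem IsArrangement.evalWord_eq {n : ℕ} {w : List (Fin n)} (h : IsArrangement n 1 w) :
    evalWord n w = z n := by
  obtain ⟨σ, hσ, rfl⟩ := h
  rw [← mk_ofList_eq_evalWord]
  refine ((Con.eq _).2 (ConGen.Rel.of _ _ ⟨σ, ?_, rfl, rfl⟩)).symm
  exact Equiv.Perm.mem_alternatingGroup.2 hσ

theorem IsArrangement.rotate {n : ℕ} (hn : Even n) {s : ℤˣ} {x : Fin n} {w : List (Fin n)}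
    (h : IsArrangement n s (x :: w)) : IsArrangement n (-s) (w ++ [x]) := by
  obtain ⟨σ, hσ, hw⟩ := h
  obtain _ | m := n
  · exact x.elim0
  rw [List.ofFn_succ, List.cons.injEq] at hw
  obtain ⟨rfl, rfl⟩ := hw
  refine ⟨σ * finRotate (m + 1), ?_, ?_⟩
  · have hm : Odd m := by rwa [Nat.even_add_one, Nat.not_even_iff_odd] at hn
    rw [Equiv.Perm.sign_mul, hσ, sign_finRotate, Nat.add_sub_cancel, hm.neg_one_pow, mul_neg_one]
  · rw [List.ofFn_succ', List.concat_eq_append]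
    simp

theorem IsArrangement.swap {n : ℕ} {s : ℤˣ} {x y : Fin n} {w : List (Fin n)}
    (h : IsArrangement n s (x :: y :: w)) : IsArrangement n (-s) (y :: x :: w) := by
  obtain ⟨σ, hσ, hw⟩ := h
  obtain _ | _ | m := n
  · exact x.elim0
  · simpa using congrArg List.length hw
  rw [List.ofFn_succ, List.ofFn_succ, List.cons.injEq, List.cons.injEq] at hw
  obtain ⟨rfl, rfl, rfl⟩ := hw
  refine ⟨σ * Equiv.swap 0 1, ?_, ?_⟩
  · rw [Equiv.Perm.sign_mul, hσ, Equiv.Perm.sign_swap (by simp), mul_neg_one]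
  · rw [List.ofFn_succ, List.ofFn_succ]
    have h2 (i : Fin m) : Equiv.swap (0 : Fin (m + 2)) 1 i.succ.succ = i.succ.succ :=
      Equiv.swap_apply_of_ne_of_ne (Fin.succ_ne_zero _)
        (fun h => Fin.succ_ne_zero i (Fin.succ_injective _ h))
    simp [h2]

theorem exists_isArrangement_one {n : ℕ} (hn : 5 ≤ n) {k l r : Fin n}
    (hkl : k ≠ l) (hlr : l ≠ r) (hkr : k ≠ r) :
    ∃ w, IsArrangement n 1 (k :: l :: r :: w) := by
  obtain ⟨m, rfl⟩ : ∃ m, n = m + 3 := ⟨n - 3, by omega⟩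
  have hpre : MulAction.IsMultiplyPretransitive (alternatingGroup (Fin (m + 3)))
      (Fin (m + 3)) 3 :=
    have := alternatingGroup.isMultiplyPretransitive (Fin (m + 3))
    MulAction.isMultiplyPretransitive_of_le (n := Nat.card (Fin (m + 3)) - 2)
      (by simp; omega) (by simp)
  have hinj : Function.Injective ![k, l, r] := by
    intro i j
    fin_cases i <;> fin_cases j <;> simp [hkl, hlr, hkr, hkl.symm, hlr.symm, hkr.symm]
  have hinj' : Function.Injective (![0, 1, 2] : Fin 3 → Fin (m + 3)) := by
    intro i j
    fin_cases i <;> fin_cases j <;> simp [Fin.ext_iff, Nat.mod_eq_of_lt (show 2 < m + 3 by omega)]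
  obtain ⟨g, hg⟩ := hpre.exists_smul_eq ⟨_, hinj'⟩ ⟨_, hinj⟩
  have h0 : g.1 0 = k := DFunLike.congr_fun hg 0
  have h1 : g.1 1 = l := DFunLike.congr_fun hg 1
  have h2 : g.1 2 = r := DFunLike.congr_fun hg 2
  refine ⟨List.ofFn fun i : Fin m => g.1 i.succ.succ.succ, g.1,
    Equiv.Perm.mem_alternatingGroup.1 g.2, ?_⟩
  rw [List.ofFn_succ, List.ofFn_succ, List.ofFn_succ, ← h0, ← h1, ← h2]
  rfl

theorem evalWord_cons (n : ℕ) (x : Fin n) (w : List (Fin n)) :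
    evalWord n (x :: w) = a n x * evalWord n w := by
  simp [evalWord]

theorem evalWord_append (n : ℕ) (v w : List (Fin n)) :
    evalWord n (v ++ w) = evalWord n v * evalWord n w := by
  simp [evalWord]

/-- If `u v` and `v u'` are both even arrangements, then `u z = z u'`. -/
theorem evalWord_mul_z {n : ℕ} {u u' v : List (Fin n)} (h : IsArrangement n 1 (u ++ v))
    (h' : IsArrangement n 1 (v ++ u')) : evalWord n u * z n = z n * evalWord n u' := by
  conv_lhs => rw [← h'.evalWord_eq]
  rw [← h.evalWord_eq, evalWord_append, evalWord_append, mul_assoc]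

theorem pair_mul_z {n : ℕ} (hn : 5 ≤ n) (heven : Even n) {k l : Fin n} (hkl : k ≠ l) :
    a n k * a n l * z n = z n * (a n k * a n l) := by
  obtain ⟨r, hr⟩ : ∃ r, r ∉ ({k, l} : Finset (Fin n)) := by
    by_contra! h
    have h1 : n ≤ ({k, l} : Finset (Fin n)).card := by
      simp [Finset.eq_univ_iff_forall.2 h]
    have h2 := Finset.card_le_two (a := k) (b := l)
    omega
  simp only [Finset.mem_insert, Finset.mem_singleton, not_or] at hr
  obtain ⟨w, hw⟩ := exists_isArrangement_one hn hkl (Ne.symm hr.2) (Ne.symm hr.1)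
  have h := (hw.rotate heven).rotate heven
  simpa [evalWord] using
    evalWord_mul_z (u := [k, l]) (u' := [k, l]) (v := r :: w) hw (by simpa using h)

theorem triple_mul_z_swap_left {n : ℕ} (hn : 5 ≤ n) (heven : Even n) {k l r : Fin n}
    (hkl : k ≠ l) (hlr : l ≠ r) (hkr : k ≠ r) :
    a n k * a n l * a n r * z n = z n * (a n l * a n k * a n r) := by
  obtain ⟨w, hw⟩ := exists_isArrangement_one hn hkl hlr hkr
  have h := ((hw.swap.rotate heven).rotate heven).rotate heven
  simpa [evalWord, mul_assoc] using
    evalWord_mul_z (u := [k, l, r]) (u' := [l, k, r]) hw (by simpa using h)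

theorem triple_mul_z_swap_right {n : ℕ} (hn : 5 ≤ n) (heven : Even n) {k l r : Fin n}
    (hkl : k ≠ l) (hlr : l ≠ r) (hkr : k ≠ r) :
    a n k * a n l * a n r * z n = z n * (a n k * a n r * a n l) := by
  obtain ⟨w, hw⟩ := exists_isArrangement_one hn hkl hlr hkr
  have h := ((hw.rotate heven).swap.rotate heven).rotate heven
  simpa [evalWord, mul_assoc] using
    evalWord_mul_z (u := [k, l, r]) (u' := [k, r, l]) hw (by simpa using h)

theorem z_mul_triple_rotate {n : ℕ} (hn : 5 ≤ n) (heven : Even n) {k l r : Fin n}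
    (hkl : k ≠ l) (hlr : l ≠ r) (hkr : k ≠ r) :
    z n * (a n k * a n l * a n r) = z n * (a n l * a n r * a n k) := by
  rw [← triple_mul_z_swap_left hn heven hkl.symm hkr hlr,
    triple_mul_z_swap_right hn heven hkl.symm hkr hlr]

theorem triple_rotate_mul_z {n : ℕ} (hn : 5 ≤ n) (heven : Even n) {k l r : Fin n}
    (hkl : k ≠ l) (hlr : l ≠ r) (hkr : k ≠ r) :
    a n k * a n l * a n r * z n = a n l * a n r * a n k * z n := by
  rw [triple_mul_z_swap_right hn heven hkl hlr hkr,
    triple_mul_z_swap_left hn heven hlr hkr.symm hkl.symm,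
    z_mul_triple_rotate hn heven hkr hlr.symm hkl]

theorem z_mul_pair_mul_pair {n : ℕ} (hn : 5 ≤ n) (heven : Even n) {i j k l : Fin n}
    (hij : i ≠ j) (hkl : k ≠ l) :
    z n * (a n i * a n j * (a n k * a n l)) = a n i * (a n j * a n k * a n l * z n) := by
  rw [← mul_assoc, ← pair_mul_z hn heven hij, mul_assoc, ← pair_mul_z hn heven hkl]
  simp only [mul_assoc]

theorem triple_mul_z_mul_of_ne {n : ℕ} (hn : 5 ≤ n) (heven : Even n) {k l r i : Fin n}
    (hkl : k ≠ l) (hlr : l ≠ r) (hkr : k ≠ r) (hik : i ≠ k) (hil : i ≠ l) (hir : i ≠ r) :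
    a n k * a n l * a n r * z n * a n i = a n i * (a n k * a n l * a n r * z n) :=
  calc
    _ = z n * (a n l * a n k * (a n r * a n i)) := by
      rw [triple_mul_z_swap_left hn heven hkl hlr hkr]; simp only [mul_assoc]
    _ = a n l * (a n i * a n k * a n r * z n) := by
      rw [z_mul_pair_mul_pair hn heven hkl.symm hir.symm,
        triple_rotate_mul_z hn heven hik hkr hir]
    _ = z n * (a n l * a n i * a n k) * a n r := by
      rw [← z_mul_pair_mul_pair hn heven hil.symm hkr]; simp only [mul_assoc]
    _ = z n * (a n i * a n k * (a n l * a n r)) := by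
      rw [z_mul_triple_rotate hn heven hil.symm hik hkl.symm]; simp only [mul_assoc]
    _ = _ := z_mul_pair_mul_pair hn heven hik hlr

theorem triple_mul_z_mul_left {n : ℕ} (hn : 5 ≤ n) (heven : Even n) {k l r : Fin n}
    (hkl : k ≠ l) (hlr : l ≠ r) (hkr : k ≠ r) :
    a n k * a n l * a n r * z n * a n k = a n k * (a n l * a n k * a n r * z n) :=
  calc
    _ = z n * (a n k * a n r * (a n l * a n k)) := by
      rw [triple_mul_z_swap_right hn heven hkl hlr hkr]; simp only [mul_assoc]
    _ = _ := by
      rw [z_mul_pair_mul_pair hn heven hkr hkl.symm,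
        triple_rotate_mul_z hn heven hlr.symm hkl.symm hkr.symm]

/-- in `M = Sₙ(Altₙ)` with `n ≥ 6` even and `k, l, r` distinct:
`(aₖaₗaᵣz)aᵢ = aᵢ(aₖaₗaᵣz)` for `i ∉ {k,l,r}`, and
`(aₖaₗaᵣz)aᵢ = aᵢ(aₗaₖaᵣz)` for `i ∈ {k,l,r}`. -/
theorem stmt11 (n : ℕ) (hn : 6 ≤ n) (heven : Even n) (k l r : Fin n)
    (hkl : k ≠ l) (hlr : l ≠ r) (hkr : k ≠ r) :
    (∀ i : Fin n, i ∉ ({k, l, r} : Set (Fin n)) →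
      (a n k * a n l * a n r * z n) * a n i = a n i * (a n k * a n l * a n r * z n)) ∧
    ∀ i : Fin n, i ∈ ({k, l, r} : Set (Fin n)) →
      (a n k * a n l * a n r * z n) * a n i = a n i * (a n l * a n k * a n r * z n) := by
  have hn' : 5 ≤ n := by omega
  refine ⟨fun i hi => ?_, fun i hi => ?_⟩
  · simp only [Set.mem_insert_iff, Set.mem_singleton_iff, not_or] at hi
    exact triple_mul_z_mul_of_ne hn' heven hkl hlr hkr hi.1 hi.2.1 hi.2.2
  · obtain rfl | rfl | rfl := hi
    · exact triple_mul_z_mul_left hn' heven hkl hlr hkr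
    · rw [triple_rotate_mul_z hn' heven hkl hlr hkr,
        triple_mul_z_mul_left hn' heven hlr hkr.symm hkl.symm,
        triple_rotate_mul_z hn' heven hlr.symm hkl.symm hkr.symm]
    · rw [← triple_rotate_mul_z hn' heven hkr.symm hkl hlr.symm,
        triple_mul_z_mul_left hn' heven hkr.symm hkl hlr.symm,
        ← triple_rotate_mul_z hn' heven hkl.symm hkr hlr]
end

section
/- Let n ≥ 6 be even and M = S_n(Alt_n), with z = a_1⋯a_n. Then ⋃_{1≤r≤n} (Mz ∩ Mza_r) = ⋃_{1≤i<j<k≤n} (M a_i a_j a_k z ∪ M a_j a_i a_k z). -/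
namespace SAlt

open Equiv

variable {n : ℕ}

/-- `l` lists the values of a permutation of `Fin n` of sign `s`. -/
def IsWordOfSign (s : ℤˣ) (l : List (Fin n)) : Prop :=
  ∃ σ : Perm (Fin n), Perm.sign σ = s ∧ List.ofFn (fun i => σ i) = l

namespace IsWordOfSign

variable {s s' : ℤˣ} {l t : List (Fin n)}

theorem length_eq (h : IsWordOfSign s l) : l.length = n := by
  obtain ⟨σ, -, rfl⟩ := h
  simp

theorem nodup (h : IsWordOfSign s l) : l.Nodup := by
  obtain ⟨σ, -, rfl⟩ := h
  exact List.nodup_ofFn.mpr σ.injective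

theorem perm (h : IsWordOfSign s l) (h' : IsWordOfSign s' t) : l.Perm t := by
  rw [List.perm_ext_iff_of_nodup h.nodup h'.nodup]
  obtain ⟨σ, -, rfl⟩ := h
  obtain ⟨τ, -, rfl⟩ := h'
  intro x
  simp only [List.mem_ofFn]
  exact iff_of_true (σ.surjective x) (τ.surjective x)

theorem unique (h : IsWordOfSign s l) (h' : IsWordOfSign s' l) : s = s' := by
  obtain ⟨σ, rfl, rfl⟩ := h
  obtain ⟨τ, rfl, h⟩ := h'
  have : τ = σ := Equiv.ext fun i => congrFun (List.ofFn_injective h) i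
  rw [this]

theorem map (h : IsWordOfSign s l) (π : Perm (Fin n)) :
    IsWordOfSign (Perm.sign π * s) (l.map π) := by
  obtain ⟨σ, rfl, rfl⟩ := h
  exact ⟨π * σ, by simp, by simp [List.map_ofFn, Function.comp_def]⟩

theorem rotate (hn : Even n) {i : Fin n} (h : IsWordOfSign s (i :: t)) :
    IsWordOfSign (-s) (t ++ [i]) := by
  obtain ⟨σ, rfl, h⟩ := h
  obtain _ | n := n
  · exact i.elim0
  refine ⟨σ * finRotate (n + 1), ?_, ?_⟩
  · rw [Perm.sign_mul, sign_finRotate, Odd.neg_one_pow (by grind)]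
    simp
  · rw [List.ofFn_succ, List.cons.injEq] at h
    rw [List.ofFn_succ', ← h.1, ← h.2]
    simp [List.concat_eq_append, Perm.mul_apply]

end IsWordOfSign

/-- Two windows of length `n` at distance one in a word cannot both carry permutations of the same sign. -/
theorem not_isWordOfSign_shift (hn : Even n) {s : ℤˣ} {i j : Fin n} {t : List (Fin n)}
    (h : IsWordOfSign s (i :: t)) (h' : IsWordOfSign s (t ++ [j])) : False := by
  have hp := h.perm h'
  have hij : i = j := by
    have := (hp.trans (List.perm_append_comm (l₁ := t) (l₂ := [j])))
    have hj : j ∉ t := by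
      have := h'.nodup
      grind
    have := this.mem_iff (a := j)
    grind
  subst hij
  have := (h.rotate hn).unique h'
  rcases Int.units_eq_one_or s with rfl | rfl <;> exact absurd this (by decide)

theorem exists_isWordOfSign_cons (hn : 6 ≤ n) {i j k : Fin n} (hij : i ≠ j) (hjk : j ≠ k)
    (hik : i ≠ k) : ∃ t, IsWordOfSign 1 (i :: j :: k :: t) := by
  have := alternatingGroup.isMultiplyPretransitive (Fin n)
  have := MulAction.isMultiplyPretransitive_of_le (G := alternatingGroup (Fin n)) (α := Fin n)
    (m := 3) (n := Nat.card (Fin n) - 2) (by simp; omega) (by simp)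
  let y : Fin 3 ↪ Fin n := ⟨![i, j, k], by
    intro p q
    fin_cases p <;> fin_cases q <;> simp [hij, hjk, hik, hij.symm, hjk.symm, hik.symm]⟩
  obtain ⟨⟨σ, hσ⟩, h⟩ := MulAction.exists_smul_eq (alternatingGroup (Fin n))
    (Fin.castLEEmb (by omega : 3 ≤ n)) y
  obtain ⟨n, rfl⟩ : ∃ m, n = m + 3 := ⟨n - 3, by omega⟩
  have h0 := DFunLike.congr_fun h 0
  have h1 := DFunLike.congr_fun h 1
  have h2 := DFunLike.congr_fun h 2
  refine ⟨List.ofFn fun i : Fin n => σ i.succ.succ.succ, σ, Perm.mem_alternatingGroup.mp hσ, ?_⟩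
  have e0 : σ 0 = i := h0
  have e1 : σ 1 = j := h1
  have e2 : σ 2 = k := h2
  rw [List.ofFn_succ, List.ofFn_succ, List.ofFn_succ, e0]
  congr

/-- The element of `Sₙ(Altₙ)` represented by a word. -/
def ofWord (l : List (Fin n)) : SAlt n := (SnCon n (AltH n)).mk' (FreeMonoid.ofList l)

theorem ofWord_append (l t : List (Fin n)) : ofWord (l ++ t) = ofWord l * ofWord t := by
  simp only [ofWord, FreeMonoid.ofList_append, map_mul]

theorem ofWord_cons (i : Fin n) (t : List (Fin n)) : ofWord (i :: t) = a n i * ofWord t :=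
  ofWord_append [i] t

theorem ofWord_nil : ofWord ([] : List (Fin n)) = 1 := map_one _

theorem ofWord_surjective : Function.Surjective (ofWord (n := n)) := fun g => by
  obtain ⟨w, rfl⟩ := Con.mk'_surjective g
  exact ⟨w.toList, rfl⟩

theorem ofWord_eq_z {x : List (Fin n)} (h : IsWordOfSign 1 x) : ofWord x = z n := by
  obtain ⟨σ, hσ, rfl⟩ := h
  refine Eq.symm ((Con.eq _).mpr (ConGen.Rel.of _ _ ⟨σ, ?_, rfl, rfl⟩))
  exact Perm.mem_alternatingGroup.mpr hσ

theorem isWordOfSign_one_id : IsWordOfSign 1 (List.ofFn fun i : Fin n => i) :=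
  ⟨1, by simp, rfl⟩

theorem mul_mul_z_eq (hn : 6 ≤ n) (heven : Even n) {i j : Fin n} (hij : i ≠ j) :
    a n i * a n j * z n = z n * (a n i * a n j) := by
  obtain ⟨k, hk⟩ : ∃ k, k ∉ ({i, j} : Finset (Fin n)) := by
    by_contra! h
    have := Finset.card_le_card (fun x _ => h x : (Finset.univ : Finset (Fin n)) ⊆ {i, j})
    have := Finset.card_le_two (a := i) (b := j)
    simp at *
    omega
  simp only [Finset.mem_insert, Finset.mem_singleton, not_or] at hk
  obtain ⟨t, ht⟩ := exists_isWordOfSign_cons hn hij (Ne.symm hk.2) (Ne.symm hk.1)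
  have h2 := (ht.rotate heven)
  rw [List.cons_append] at h2
  replace h2 := h2.rotate heven
  rw [neg_neg] at h2
  conv_lhs => rw [← ofWord_eq_z h2]
  conv_rhs => rw [← ofWord_eq_z ht]
  simp only [ofWord_append, ofWord_cons, ofWord_nil, mul_one, mul_assoc]

theorem mul_mul_mul_z_eq_of_odd (hn : 6 ≤ n) (heven : Even n) {i j k : Fin n} (hij : i ≠ j)
    (hjk : j ≠ k) (hik : i ≠ k) (π : Perm (Fin n)) (hπ : Perm.sign π = -1)
    (hfix : ∀ x, x ≠ i → x ≠ j → x ≠ k → π x = x) :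
    a n i * a n j * a n k * z n = z n * (a n (π i) * a n (π j) * a n (π k)) := by
  obtain ⟨t, ht⟩ := exists_isWordOfSign_cons hn hij hjk hik
  have hmap : t.map π = t := by
    have := ht.nodup
    exact (List.map_congr_left (g := id) fun x hx =>
      hfix x (by grind) (by grind) (by grind)).trans t.map_id
  have h3 := ht.map π
  simp only [List.map_cons, hmap, hπ] at h3
  replace h3 := h3.rotate heven
  simp only [List.cons_append] at h3
  replace h3 := h3.rotate heven
  simp only [List.cons_append] at h3
  replace h3 := h3.rotate heven
  simp only [mul_one, neg_neg] at h3
  conv_lhs => rw [← ofWord_eq_z h3]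
  conv_rhs => rw [← ofWord_eq_z ht]
  simp only [ofWord_append, ofWord_cons, ofWord_nil, mul_one, mul_assoc]

theorem mul_mul_mul_z_eq (hn : 6 ≤ n) (heven : Even n) {i j k : Fin n} (hij : i ≠ j)
    (hjk : j ≠ k) (hik : i ≠ k) :
    a n i * a n j * a n k * z n = z n * (a n j * a n i * a n k) := by
  have := mul_mul_mul_z_eq_of_odd hn heven hij hjk hik (swap i j) (Perm.sign_swap hij)
    (fun x hi hj _ => swap_apply_of_ne_of_ne hi hj)
  rwa [swap_apply_left, swap_apply_right, swap_apply_of_ne_of_ne hik.symm hjk.symm] at this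

theorem mul_mul_mul_z_rotate (hn : 6 ≤ n) (heven : Even n) {i j k : Fin n} (hij : i ≠ j)
    (hjk : j ≠ k) (hik : i ≠ k) :
    a n i * a n j * a n k * z n = a n j * a n k * a n i * z n := by
  have := mul_mul_mul_z_eq_of_odd hn heven hjk hik.symm hij.symm (swap k i)
    (Perm.sign_swap hik.symm) (fun x _ hk hi => swap_apply_of_ne_of_ne hk hi)
  rw [swap_apply_left, swap_apply_right, swap_apply_of_ne_of_ne hjk hij.symm] at this
  rw [this, mul_mul_mul_z_eq hn heven hij hjk hik]

/-- Membership in the left ideal generated by the `aᵢaⱼaₖz` with `i`, `j`, `k` distinct. -/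
def InTripleIdeal (g : SAlt n) : Prop :=
  ∃ m i j k, i ≠ j ∧ j ≠ k ∧ i ≠ k ∧ g = m * (a n i * a n j * a n k * z n)

/-- Products of words of length two in distinct letters. -/
inductive IsPairWord : List (Fin n) → Prop
  | nil : IsPairWord []
  | cons {i j : Fin n} {v : List (Fin n)} (hij : i ≠ j) (hv : IsPairWord v) :
    IsPairWord (i :: j :: v)

theorem IsPairWord.even_length {v : List (Fin n)} (hv : IsPairWord v) : Even v.length := by
  induction hv with
  | nil => simp
  | cons _ _ ih => simp only [List.length_cons]; grind

namespace InTripleIdeal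

theorem mul_left {g : SAlt n} (h : InTripleIdeal g) (m : SAlt n) : InTripleIdeal (m * g) := by
  obtain ⟨m', i, j, k, hij, hjk, hik, rfl⟩ := h
  exact ⟨m * m', i, j, k, hij, hjk, hik, (mul_assoc ..).symm⟩

theorem mul_pair (hn : 6 ≤ n) (heven : Even n) {g : SAlt n} (h : InTripleIdeal g) {p q : Fin n}
    (hpq : p ≠ q) : InTripleIdeal (g * (a n p * a n q)) := by
  obtain ⟨m, i, j, k, hij, hjk, hik, rfl⟩ := h
  have key : ∀ {i j k : Fin n}, k ≠ p → k ≠ q →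
      InTripleIdeal (m * (a n i * a n j * a n k * z n) * (a n p * a n q)) := by
    intro i j k hp hq
    refine ⟨m * a n i * a n j, k, p, q, hp, hpq, hq, ?_⟩
    simp only [mul_assoc]
    rw [← mul_mul_z_eq hn heven hpq]
    simp only [mul_assoc]
  by_cases hk : k ≠ p ∧ k ≠ q
  · exact key hk.1 hk.2
  rw [mul_mul_mul_z_rotate hn heven hij hjk hik]
  by_cases hi : i ≠ p ∧ i ≠ q
  · exact key hi.1 hi.2
  rw [mul_mul_mul_z_rotate hn heven hjk hik.symm hij.symm]
  exact key (by grind) (by grind)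

theorem mul_pairWord (hn : 6 ≤ n) (heven : Even n) {v : List (Fin n)} (hv : IsPairWord v)
    {g : SAlt n} (h : InTripleIdeal g) : InTripleIdeal (g * ofWord v) := by
  induction hv generalizing g with
  | nil => simpa [ofWord_nil] using h
  | @cons i j v hij _ ih =>
    have := ih (h.mul_pair hn heven hij)
    simpa only [ofWord_cons, mul_assoc] using this

end InTripleIdeal

theorem inTripleIdeal_z_mul_four (hn : 6 ≤ n) (heven : Even n) {i j k l : Fin n} (hij : i ≠ j)
    (hjk : j ≠ k) (hik : i ≠ k) (hkl : k ≠ l) :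
    InTripleIdeal (z n * (a n i * a n j) * (a n k * a n l)) := by
  by_cases hjl : l = j
  · subst hjl
    refine ⟨a n l, k, i, l, hik.symm, hij, hjk.symm, ?_⟩
    calc z n * (a n i * a n l) * (a n k * a n l)
        = z n * (a n i * a n l * a n k) * a n l := by simp only [mul_assoc]
      _ = a n l * (a n i * a n k * z n) * a n l := by
          rw [← mul_mul_mul_z_eq hn heven hij.symm hik hjk]; simp only [mul_assoc]
      _ = a n l * (z n * (a n i * a n k * a n l)) := by
          rw [mul_mul_z_eq hn heven hik]; simp only [mul_assoc]
      _ = _ := by rw [mul_mul_mul_z_eq hn heven hik.symm hij hjk.symm]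
  · refine ⟨a n i, j, k, l, hjk, hkl, Ne.symm hjl, ?_⟩
    rw [← mul_mul_z_eq hn heven hij, mul_assoc, ← mul_mul_z_eq hn heven hkl]
    simp only [mul_assoc]

theorem IsPairWord.inTripleIdeal (hn : 6 ≤ n) (heven : Even n) {v : List (Fin n)}
    (hv : IsPairWord v) {v₁ v₂ : List (Fin n)} {i j k : Fin n} (hij : i ≠ j) (hjk : j ≠ k)
    (hik : i ≠ k) (h : v = v₁ ++ i :: j :: k :: v₂) : InTripleIdeal (z n * ofWord v) := by
  induction hv generalizing v₁ with
  | nil => simp at h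
  | @cons p q v hpq hv ih =>
    match v₁ with
    | [] =>
      simp only [List.nil_append, List.cons.injEq] at h
      obtain ⟨rfl, rfl, rfl⟩ := h
      cases hv with
      | @cons _ l _ hkl hv =>
        have := (inTripleIdeal_z_mul_four hn heven hij hjk hik hkl).mul_pairWord hn heven hv
        simpa only [ofWord_cons, mul_assoc] using this
    | [r] =>
      simp only [List.cons_append, List.nil_append, List.cons.injEq] at h
      obtain ⟨rfl, rfl, rfl⟩ := h
      cases hv with
      | cons hjk hv =>
        have h0 : InTripleIdeal (z n * (a n p * a n q) * (a n j * a n k)) := by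
          refine ⟨a n p, q, j, k, hij, hjk, hik, ?_⟩
          rw [← mul_mul_z_eq hn heven hpq, mul_assoc, ← mul_mul_z_eq hn heven hjk]
          simp only [mul_assoc]
        simpa only [ofWord_cons, mul_assoc] using h0.mul_pairWord hn heven hv
    | r :: r' :: v₁ =>
      simp only [List.cons_append, List.cons.injEq] at h
      have := (ih h.2.2).mul_left (a n p * a n q)
      rw [← mul_assoc, mul_mul_z_eq hn heven hpq] at this
      simpa only [ofWord_cons, mul_assoc] using this

/-- Words with a window that carries an even permutation and is followed by a pair word. -/
def HasEvenWindow (w : List (Fin n)) : Prop :=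
  ∃ u x v, w = u ++ x ++ v ∧ IsWordOfSign 1 x ∧ IsPairWord v

theorem exists_eq_append_triple {α : Type*} {l : List α} (h : 3 ≤ l.length) :
    ∃ t i j k, l = t ++ [i, j, k] := by
  obtain ⟨i, j, k, hd⟩ := List.length_eq_three.mp
    (show (l.drop (l.length - 3)).length = 3 by rw [List.length_drop]; omega)
  exact ⟨l.take (l.length - 3), i, j, k, by rw [← hd, List.take_append_drop]⟩

/-- Outside the triple ideal, what follows any even window of a word in `HasEvenWindow` is again
a pair word, or still contains an even window followed by a pair word. -/
theorem isPairWord_or_hasEvenWindow (hn : 6 ≤ n) (heven : Even n) {p x q : List (Fin n)}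
    (hx : IsWordOfSign 1 x) (hw : HasEvenWindow (p ++ x ++ q))
    (hI : ¬ InTripleIdeal (ofWord (p ++ x ++ q))) : IsPairWord q ∨ HasEvenWindow q := by
  obtain ⟨u, y, v, h, hy, hv⟩ := hw
  have hxl := hx.length_eq
  have hyl := hy.length_eq
  have hlen := congrArg List.length h
  simp only [List.length_append] at hlen
  have hyv : ofWord (y ++ v) = z n * ofWord v := by rw [ofWord_append, ofWord_eq_z hy]
  rw [h, List.append_assoc, ofWord_append, hyv] at hI
  rw [List.append_assoc, List.append_assoc, List.append_eq_append_iff] at h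
  rcases h with ⟨e, rfl, h⟩ | ⟨e, rfl, h⟩
  · match e with
    | [] =>
      rw [List.nil_append] at h
      obtain ⟨rfl, rfl⟩ := List.append_inj h (by omega)
      exact .inl hv
    | [i] =>
      exfalso
      obtain _ | ⟨i', t⟩ := x
      · simp at hxl; omega
      simp only [List.cons_append, List.nil_append, List.cons.injEq] at h
      obtain ⟨rfl, h⟩ := h
      obtain _ | ⟨j, q'⟩ := q
      · simp at *; omega
      rw [List.append_cons] at h
      obtain ⟨rfl, -⟩ := List.append_inj h (by simp at *; omega)
      exact not_isWordOfSign_shift heven hx hy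
    | [i, j] =>
      left
      obtain _ | ⟨i', _ | ⟨j', t⟩⟩ := x
      · simp at hxl; omega
      · simp at hxl; omega
      simp only [List.cons_append, List.nil_append, List.cons.injEq] at h
      obtain ⟨rfl, rfl, h⟩ := h
      obtain _ | ⟨k, _ | ⟨l, q'⟩⟩ := q
      · simp at *; omega
      · simp at *; omega
      rw [List.append_cons, List.append_cons] at h
      obtain ⟨rfl, rfl⟩ := List.append_inj h (by simp at *; omega)
      refine .cons ?_ hv
      have := hy.nodup
      grind
    | e₀ :: e₁ :: e₂ :: e₃ =>
      generalize he : e₀ :: e₁ :: e₂ :: e₃ = e at *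
      have he3 : 3 ≤ e.length := by rw [← he]; simp
      rcases List.append_eq_append_iff.mp h with ⟨t, ht, -⟩ | ⟨t, ht, -⟩
      · exact .inr ⟨t, y, v, by simp_all, hy, hv⟩
      · exfalso
        obtain ⟨e', i, j, k, rfl⟩ := exists_eq_append_triple he3
        have := hx.nodup
        rw [ht] at this
        have hijk : InTripleIdeal (ofWord [i, j, k] * z n) :=
          ⟨1, i, j, k, by grind, by grind, by grind, by
            simp only [ofWord_cons, ofWord_nil, mul_one, one_mul, mul_assoc]⟩
        apply hI
        have := (hijk.mul_pairWord hn heven hv).mul_left (ofWord (p ++ e'))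
        simpa only [ofWord_append, mul_assoc] using this
  · left
    match e with
    | [] =>
      rw [List.nil_append] at h
      obtain ⟨rfl, rfl⟩ := List.append_inj h (by omega)
      exact hv
    | [i] =>
      exfalso
      obtain _ | ⟨i', t⟩ := y
      · simp at hyl; omega
      simp only [List.cons_append, List.nil_append, List.cons.injEq] at h
      obtain ⟨rfl, h⟩ := h
      obtain _ | ⟨j, v'⟩ := v
      · simp at *; omega
      rw [List.append_cons] at h
      obtain ⟨rfl, -⟩ := List.append_inj h (by simp at *; omega)
      exact not_isWordOfSign_shift heven hy hx
    | [i, j] =>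
      obtain _ | ⟨i', _ | ⟨j', t⟩⟩ := y
      · simp at hyl; omega
      · simp at hyl; omega
      simp only [List.cons_append, List.nil_append, List.cons.injEq] at h
      obtain ⟨rfl, rfl, h⟩ := h
      cases hv with
      | nil => simp at *; omega
      | cons _ hv =>
        rw [List.append_cons, List.append_cons] at h
        obtain ⟨-, rfl⟩ := List.append_inj h (by simp at *; omega)
        exact hv
    | e₀ :: e₁ :: e₂ :: e₃ =>
      exfalso
      generalize he : e₀ :: e₁ :: e₂ :: e₃ = e at *
      have he3 : 3 ≤ e.length := by rw [← he]; simp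
      obtain ⟨t, i, j, k, rfl⟩ := exists_eq_append_triple (l := x) (by omega)
      have hd := hx.nodup
      have hs : y ++ v = (e ++ t) ++ ([i, j, k] ++ q) := by rw [h]; simp
      obtain ⟨v₁, hv₁⟩ := List.suffix_of_suffix_length_le ⟨_, hs.symm⟩ (List.suffix_append y v)
        (by simp at *; omega)
      exact hI ((hv.inTripleIdeal hn heven (by grind) (by grind) (by grind) hv₁.symm).mul_left _)

theorem hasEvenWindow_of_isPairWord_or {p y q : List (Fin n)} (hy : IsWordOfSign 1 y)
    (h : IsPairWord q ∨ HasEvenWindow q) : HasEvenWindow (p ++ y ++ q) := by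
  rcases h with hq | ⟨u, x, v, rfl, hx, hv⟩
  · exact ⟨p, y, q, rfl, hy, hq⟩
  · exact ⟨p ++ y ++ u, x, v, by simp only [List.append_assoc], hx, hv⟩

/-- A property of words that is stable under replacing an even window by another one only depends
on the element of `Sₙ(Altₙ)` the word represents. -/
theorem iff_of_ofWord_eq {P : List (Fin n) → Prop}
    (hP : ∀ p q x y, IsWordOfSign 1 x → IsWordOfSign 1 y → P (p ++ x ++ q) → P (p ++ y ++ q))
    {w w' : List (Fin n)} (h : ofWord w = ofWord w') : P w ↔ P w' := by
  let c : Con (FreeMonoid (Fin n)) :=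
    { r := fun w w' => ∀ p q : List (Fin n), P (p ++ w.toList ++ q) ↔ P (p ++ w'.toList ++ q)
      iseqv := ⟨fun _ _ _ => Iff.rfl, fun h p q => (h p q).symm,
        fun h h' p q => (h p q).trans (h' p q)⟩
      mul' := by
        intro w x y v h h' p q
        have h1 := h p (y.toList ++ q)
        have h2 := h' (p ++ x.toList) q
        simp only [FreeMonoid.toList_mul, List.append_assoc] at *
        exact h1.trans h2 }
  have hle : SnCon n (AltH n) ≤ c := by
    refine Con.conGen_le.mpr ?_
    rintro _ _ ⟨σ, hσ, rfl, rfl⟩ p q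
    have hw : IsWordOfSign 1 (List.ofFn fun i => σ i) := ⟨σ, Perm.mem_alternatingGroup.mp hσ, rfl⟩
    exact ⟨hP p q _ _ isWordOfSign_one_id hw, hP p q _ _ hw isWordOfSign_one_id⟩
  simpa using hle ((Con.eq _).mp h) [] []

theorem inTripleIdeal_of_mem (hn : 6 ≤ n) (heven : Even n) {m m' : SAlt n} {r : Fin n}
    (h : m * z n = m' * (z n * a n r)) : InTripleIdeal (m * z n) := by
  by_contra hI
  obtain ⟨u, rfl⟩ := ofWord_surjective m
  obtain ⟨p, rfl⟩ := ofWord_surjective m'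
  let x : List (Fin n) := List.ofFn fun i => i
  have hx : IsWordOfSign 1 x := isWordOfSign_one_id
  have hu : ofWord (u ++ x) = ofWord u * z n := by rw [ofWord_append, ofWord_eq_z hx]
  have hp : ofWord (p ++ x ++ [r]) = ofWord p * (z n * a n r) := by
    rw [ofWord_append, ofWord_append, ofWord_eq_z hx, ofWord_cons, ofWord_nil, mul_one, mul_assoc]
  have hpI : ¬ InTripleIdeal (ofWord (p ++ x ++ [r])) := by rwa [hp, ← h]
  have key := iff_of_ofWord_eq (P := fun w => HasEvenWindow w ∧ ¬ InTripleIdeal (ofWord w))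
    (by
      rintro p q x y hx hy ⟨hw, hI⟩
      refine ⟨hasEvenWindow_of_isPairWord_or hy (isPairWord_or_hasEvenWindow hn heven hx hw hI), ?_⟩
      rwa [ofWord_append, ofWord_append, ofWord_eq_z hy, ← ofWord_eq_z hx, ← ofWord_append,
        ← ofWord_append])
    (hu.trans (h.trans hp.symm))
  obtain ⟨hw, -⟩ := key.mp ⟨⟨u, x, [], by simp, hx, .nil⟩, by rwa [hu]⟩
  rcases isPairWord_or_hasEvenWindow hn heven hx hw hpI with hr | ⟨u, y, v, hr, hy, -⟩
  · simpa using hr.even_length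
  · have := congrArg List.length hr
    simp only [List.length_append, List.length_singleton, hy.length_eq] at this
    omega

theorem InTripleIdeal.exists_lt (hn : 6 ≤ n) (heven : Even n) {g : SAlt n}
    (h : InTripleIdeal g) : ∃ i j k : Fin n, i < j ∧ j < k ∧
      ((∃ m, g = m * (a n i * a n j * a n k * z n)) ∨
        ∃ m, g = m * (a n j * a n i * a n k * z n)) := by
  obtain ⟨m, i, j, k, hij, hjk, hik, rfl⟩ := h
  have r₁ := mul_mul_mul_z_rotate hn heven hij hjk hik
  have r₂ := mul_mul_mul_z_rotate hn heven hjk hik.symm hij.symm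
  rcases lt_or_gt_of_ne hij with h₁ | h₁ <;> rcases lt_or_gt_of_ne hjk with h₂ | h₂ <;>
    rcases lt_or_gt_of_ne hik with h₃ | h₃
  · exact ⟨i, j, k, h₁, h₂, .inl ⟨m, rfl⟩⟩
  · exact absurd (h₁.trans h₂) h₃.not_gt
  · exact ⟨i, k, j, h₃, h₂, .inr ⟨m, by rw [r₁, r₂]⟩⟩
  · exact ⟨k, i, j, h₃, h₁, .inl ⟨m, by rw [r₁, r₂]⟩⟩
  · exact ⟨j, i, k, h₁, h₃, .inr ⟨m, rfl⟩⟩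
  · exact ⟨j, k, i, h₂, h₃, .inl ⟨m, by rw [r₁]⟩⟩
  · exact absurd (h₂.trans h₁) h₃.not_gt
  · exact ⟨k, j, i, h₂, h₁, .inr ⟨m, by rw [r₁]⟩⟩

theorem InTripleIdeal.exists_eq_mul_z (hn : 6 ≤ n) (heven : Even n) {g : SAlt n}
    (h : InTripleIdeal g) :
    ∃ r, (∃ m, g = m * z n) ∧ ∃ m, g = m * (z n * a n r) := by
  obtain ⟨m, i, j, k, hij, hjk, hik, rfl⟩ := h
  refine ⟨k, ⟨m * (a n i * a n j * a n k), by simp only [mul_assoc]⟩,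
    m * (a n j * a n i), ?_⟩
  rw [mul_mul_mul_z_eq hn heven hij hjk hik, ← mul_assoc (z n), ← mul_mul_z_eq hn heven hij.symm]
  simp only [mul_assoc]

end SAlt

/-- in `M = Sₙ(Altₙ)` with `n ≥ 6` even,
`⋃_{1≤r≤n} (Mz ∩ Mzaᵣ) = ⋃_{1≤i<j<k≤n} (Maᵢaⱼaₖz ∪ Maⱼaᵢaₖz)`. -/
theorem stmt12 (n : ℕ) (hn : 6 ≤ n) (heven : Even n) :
    (⋃ r : Fin n,
        {x : SAlt n | ∃ m, x = m * z n} ∩ {x | ∃ m, x = m * (z n * a n r)}) =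
      ⋃ (i : Fin n) (j : Fin n) (k : Fin n) (_ : i < j) (_ : j < k),
        ({x : SAlt n | ∃ m, x = m * (a n i * a n j * a n k * z n)} ∪
          {x | ∃ m, x = m * (a n j * a n i * a n k * z n)}) := by
  ext g
  simp only [Set.mem_iUnion, Set.mem_inter_iff, Set.mem_union, Set.mem_ofPred_eq, exists_prop]
  constructor
  · rintro ⟨r, ⟨m, rfl⟩, m', h⟩
    exact (SAlt.inTripleIdeal_of_mem hn heven h).exists_lt hn heven
  · rintro ⟨i, j, k, hij, hjk, ⟨m, rfl⟩ | ⟨m, rfl⟩⟩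
    · exact SAlt.InTripleIdeal.exists_eq_mul_z hn heven
        ⟨m, i, j, k, hij.ne, hjk.ne, (hij.trans hjk).ne, rfl⟩
    · exact SAlt.InTripleIdeal.exists_eq_mul_z hn heven
        ⟨m, j, i, k, hij.ne', (hij.trans hjk).ne, hjk.ne, rfl⟩
end

section
/- Let n ≥ 4 and G = G_n(Alt_n). Let C be the subgroup generated by the commutator a_1a_2a_1^{-1}a_2^{-1}. Then C is central, and G/C is a free abelian group of rank n (with basis the images of a_1,...,a_n). -/
/-- The relator set of `Gₙ(Altₙ)`: the words `(a₁a₂⋯aₙ)(a_{σ(1)}⋯a_{σ(n)})⁻¹`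
for all even permutations `σ`. -/
def GAltRels (n : ℕ) : Set (FreeGroup (Fin n)) :=
  { w | ∃ σ ∈ alternatingGroup (Fin n),
      w = (List.ofFn (fun i : Fin n => FreeGroup.of i)).prod *
        ((List.ofFn (fun i : Fin n => FreeGroup.of (σ i))).prod)⁻¹ }

/-- The group `Gₙ(Altₙ) = ⟨a₁,…,aₙ ∣ a₁a₂⋯aₙ = a_{σ(1)}⋯a_{σ(n)}, σ ∈ Altₙ⟩`. -/
abbrev GAlt (n : ℕ) : Type := PresentedGroup (GAltRels n)

/-- The generator `aᵢ` of `Gₙ(Altₙ)`. -/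
def b (n : ℕ) (i : Fin n) : GAlt n := PresentedGroup.of i

/-- The central subgroup `C = {1, a₁a₂a₁⁻¹a₂⁻¹}` of `Gₙ(Altₙ)`, i.e. the subgroup
generated by the commutator `a₁a₂a₁⁻¹a₂⁻¹`. -/
def Csub (n : ℕ) [NeZero n] : Subgroup (GAlt n) :=
  Subgroup.zpowers (b n 0 * b n 1 * (b n 0)⁻¹ * (b n 1)⁻¹)

theorem prod_b_perm_eq (n : ℕ) (σ : Equiv.Perm (Fin n)) (hσ : Equiv.Perm.sign σ = 1) :
    (List.ofFn fun i => b n (σ i)).prod = (List.ofFn fun i => b n i).prod := by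
  have h : (List.ofFn (fun i : Fin n => FreeGroup.of i)).prod *
      ((List.ofFn (fun i : Fin n => FreeGroup.of (σ i))).prod)⁻¹ ∈ GAltRels n :=
    ⟨σ, by simpa [Equiv.Perm.mem_alternatingGroup] using hσ, rfl⟩
  have h1 := PresentedGroup.one_of_mem h
  rw [map_mul, map_inv, mul_inv_eq_one, map_list_prod, map_list_prod, List.map_ofFn,
    List.map_ofFn] at h1
  exact h1.symm

theorem fin_zero_one_two_three_pairwise_ne (m : ℕ) :
    (0 : Fin (m + 4)) ≠ 1 ∧ (0 : Fin (m + 4)) ≠ 2 ∧ (1 : Fin (m + 4)) ≠ 2 ∧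
      (0 : Fin (m + 4)) ≠ 3 ∧ (1 : Fin (m + 4)) ≠ 3 ∧ (2 : Fin (m + 4)) ≠ 3 := by
  have h2 : 2 % (m + 4) = 2 := Nat.mod_eq_of_lt (by omega)
  have h3 : 3 % (m + 4) = 3 := Nat.mod_eq_of_lt (by omega)
  simp [Fin.ext_iff, h2, h3]

/-- A permutation of `Fin (m + 4)` with prescribed values at `0`, `1` and `2`. -/
theorem exists_perm_of_ne {m : ℕ} {i j k : Fin (m + 4)} (hij : i ≠ j) (hik : i ≠ k)
    (hjk : j ≠ k) : ∃ σ : Equiv.Perm (Fin (m + 4)), σ 0 = i ∧ σ 1 = j ∧ σ 2 = k := by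
  obtain ⟨h01, h02, h12, -⟩ := fin_zero_one_two_three_pairwise_ne m
  obtain ⟨σ, h0⟩ : ∃ σ : Equiv.Perm (Fin (m + 4)), σ 0 = i := ⟨Equiv.swap 0 i, by simp⟩
  obtain ⟨τ, t0, t1⟩ : ∃ σ : Equiv.Perm (Fin (m + 4)), σ 0 = i ∧ σ 1 = j := by
    refine ⟨Equiv.swap (σ 1) j * σ, ?_, by simp⟩
    rw [Equiv.Perm.mul_apply, Equiv.swap_apply_of_ne_of_ne (σ.injective.ne h01) (h0 ▸ hij), h0]
  refine ⟨Equiv.swap (τ 2) k * τ, ?_, ?_, by simp⟩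
  · rw [Equiv.Perm.mul_apply, Equiv.swap_apply_of_ne_of_ne (τ.injective.ne h02) (t0 ▸ hik), t0]
  · rw [Equiv.Perm.mul_apply, Equiv.swap_apply_of_ne_of_ne (τ.injective.ne h12) (t1 ▸ hjk), t1]

theorem b_mul_b_mul_b_rotate {m : ℕ} {i j k : Fin (m + 4)} (hij : i ≠ j) (hik : i ≠ k)
    (hjk : j ≠ k) :
    b (m + 4) i * (b (m + 4) j * b (m + 4) k) = b (m + 4) j * b (m + 4) k * b (m + 4) i := by
  obtain ⟨σ, rfl, rfl, rfl⟩ := exists_perm_of_ne hij hik hjk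
  obtain ⟨h01, h02, h12, h03, h13, h23⟩ := fin_zero_one_two_three_pairwise_ne m
  have s1 : Fin.succ (0 : Fin (m + 3)) = 1 := rfl
  have s2 : Fin.succ (Fin.succ (0 : Fin (m + 2))) = 2 := rfl
  have s3 : Fin.succ (Fin.succ (Fin.succ (0 : Fin (m + 1)))) = 3 := rfl
  have word (τ : Equiv.Perm (Fin (m + 4))) : (List.ofFn fun i => b (m + 4) (τ i)).prod =
      b (m + 4) (τ 0) * (b (m + 4) (τ 1) * (b (m + 4) (τ 2) * (b (m + 4) (τ 3) *
        (List.ofFn fun i : Fin m => b (m + 4) (τ i.succ.succ.succ.succ)).prod))) := by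
    simp only [List.ofFn_succ, List.prod_cons, s1, s2, s3]
  have fix01 (i : Fin m) :
      Equiv.swap (0 : Fin (m + 4)) 1 i.succ.succ.succ.succ = i.succ.succ.succ.succ :=
    Equiv.swap_apply_of_ne_of_ne (Fin.succ_ne_zero _)
      ((Fin.succ_injective _).ne (Fin.succ_ne_zero _))
  have fix12 (i : Fin m) :
      Equiv.swap (1 : Fin (m + 4)) 2 i.succ.succ.succ.succ = i.succ.succ.succ.succ :=
    Equiv.swap_apply_of_ne_of_ne ((Fin.succ_injective _).ne (Fin.succ_ne_zero _))
      ((Fin.succ_injective _).ne ((Fin.succ_injective _).ne (Fin.succ_ne_zero _)))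
  have fix23 (i : Fin m) :
      Equiv.swap (2 : Fin (m + 4)) 3 i.succ.succ.succ.succ = i.succ.succ.succ.succ :=
    Equiv.swap_apply_of_ne_of_ne
      ((Fin.succ_injective _).ne ((Fin.succ_injective _).ne (Fin.succ_ne_zero _)))
      ((Fin.succ_injective _).ne ((Fin.succ_injective _).ne ((Fin.succ_injective _).ne
        (Fin.succ_ne_zero _))))
  have e0 : Equiv.swap (1 : Fin (m + 4)) 2 0 = 0 := Equiv.swap_apply_of_ne_of_ne h01 h02
  have e0' : Equiv.swap (2 : Fin (m + 4)) 3 0 = 0 := Equiv.swap_apply_of_ne_of_ne h02 h03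
  have e1 : Equiv.swap (2 : Fin (m + 4)) 3 1 = 1 := Equiv.swap_apply_of_ne_of_ne h12 h13
  have e2 : Equiv.swap (0 : Fin (m + 4)) 1 2 = 2 :=
    Equiv.swap_apply_of_ne_of_ne h02.symm h12.symm
  have e3 : Equiv.swap (0 : Fin (m + 4)) 1 3 = 3 :=
    Equiv.swap_apply_of_ne_of_ne h03.symm h13.symm
  have e3' : Equiv.swap (1 : Fin (m + 4)) 2 3 = 3 :=
    Equiv.swap_apply_of_ne_of_ne h13.symm h23.symm
  by_cases hσ : Equiv.Perm.sign σ = 1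
  · have hc := (prod_b_perm_eq _ (σ * (Equiv.swap 0 1 * Equiv.swap 1 2)) (by
      simp [hσ, h01, h12])).trans (prod_b_perm_eq _ σ hσ).symm
    rw [word, word] at hc
    simp only [Equiv.Perm.mul_apply, fix01, fix12, Equiv.swap_apply_left,
      Equiv.swap_apply_right, e0, e2, e3, e3'] at hc
    simpa only [← mul_assoc, mul_left_inj] using hc.symm
  · have hσ' : Equiv.Perm.sign σ = -1 := (Int.units_eq_one_or _).resolve_left hσ
    have hρ : Equiv.Perm.sign (σ * (Equiv.swap 2 3 * Equiv.swap 1 2 * Equiv.swap 0 1)) = 1 := by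
      simp [hσ', h01, h12, h23]
    have hc := (prod_b_perm_eq _ (σ * (Equiv.swap 2 3 * Equiv.swap 1 2 * Equiv.swap 0 1) *
      (Equiv.swap 1 2 * Equiv.swap 2 3)) (by
        rw [Equiv.Perm.sign_mul, hρ]; simp [h12, h23])).trans
      (prod_b_perm_eq _ _ hρ).symm
    rw [word, word] at hc
    simp only [Equiv.Perm.mul_apply, fix01, fix12, fix23, Equiv.swap_apply_left,
      Equiv.swap_apply_right, e0, e0', e1, e2, e3, e3', mul_right_inj] at hc
    simpa only [← mul_assoc, mul_left_inj] using hc.symm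

section Commutators

variable {G ι : Type*} [Group G] {a : ι → G}

open scoped commutatorElement

theorem commute_commutatorElement_of_rotate
    (h : ∀ i j k, i ≠ j → i ≠ k → j ≠ k → a i * (a j * a k) = a j * a k * a i)
    {i j k : ι} (hij : i ≠ j) (hik : i ≠ k) (hjk : j ≠ k) :
    Commute (a i) ⁅a j, a k⁆ := by
  have h1 : Commute (a i) (a j * a k) := h i j k hij hik hjk
  have h2 : Commute (a i) (a k * a j) := h i k j hik hij hjk.symm
  have h3 : ⁅a j, a k⁆ = a j * a k * (a k * a j)⁻¹ := by
    rw [commutatorElement_def]; group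
  rw [h3]
  exact h1.mul_right h2.inv_right

theorem commutatorElement_mul_eq_one_of_rotate
    (h : ∀ i j k, i ≠ j → i ≠ k → j ≠ k → a i * (a j * a k) = a j * a k * a i)
    {i j k : ι} (hij : i ≠ j) (hik : i ≠ k) (hjk : j ≠ k) :
    ⁅a i, a j⁆ * ⁅a i, a k⁆ = 1 := by
  have h1 := commute_commutatorElement_of_rotate h hij.symm hjk hik
  calc ⁅a i, a j⁆ * ⁅a i, a k⁆ = ⁅a i, a j⁆ * (a j * ⁅a i, a k⁆ * (a j)⁻¹) := by
        rw [h1.eq, mul_inv_cancel_right]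
    _ = a i * (a j * a k) * (a i)⁻¹ * (a k)⁻¹ * (a j)⁻¹ := by
        simp only [commutatorElement_def]; group
    _ = 1 := by rw [h i j k hij hik hjk]; group

theorem commutatorElement_eq_of_rotate
    (h : ∀ i j k, i ≠ j → i ≠ k → j ≠ k → a i * (a j * a k) = a j * a k * a i)
    {i j k l : ι} (hij : i ≠ j) (hik : i ≠ k) (hil : i ≠ l) (hjk : j ≠ k) (hjl : j ≠ l)
    (hkl : k ≠ l) :
    ⁅a i, a j⁆ = ⁅a i, a k⁆ ∧ ⁅a i, a j⁆ = ⁅a j, a i⁆ := by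
  have h1 := eq_inv_of_mul_eq_one_left (commutatorElement_mul_eq_one_of_rotate h hij hik hjk)
  have h2 := eq_inv_of_mul_eq_one_left (commutatorElement_mul_eq_one_of_rotate h hij hil hjl)
  have h3 := eq_inv_of_mul_eq_one_left (commutatorElement_mul_eq_one_of_rotate h hik hil hkl)
  have h4 : ⁅a i, a j⁆ = ⁅a i, a k⁆ := h2.trans h3.symm
  refine ⟨h4, ?_⟩
  rw [← commutatorElement_inv (a i) (a j)]
  exact h1.trans (congrArg _ h4.symm)

end Commutators

open scoped commutatorElement in
theorem commutatorElement_b_eq {m : ℕ} {i j : Fin (m + 4)} (hij : i ≠ j) :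
    ⁅b (m + 4) i, b (m + 4) j⁆ = ⁅b (m + 4) 0, b (m + 4) 1⁆ := by
  obtain ⟨h01, -, -, h03, h13, h23⟩ := fin_zero_one_two_three_pairwise_ne m
  have key {i j k : Fin (m + 4)} (hij : i ≠ j) (hik : i ≠ k) (hjk : j ≠ k) :
      ⁅b (m + 4) i, b (m + 4) j⁆ = ⁅b (m + 4) i, b (m + 4) k⁆ ∧
        ⁅b (m + 4) i, b (m + 4) j⁆ = ⁅b (m + 4) j, b (m + 4) i⁆ := by
    obtain ⟨σ, rfl, rfl, rfl⟩ := exists_perm_of_ne hij hik hjk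
    exact commutatorElement_eq_of_rotate (fun _ _ _ => b_mul_b_mul_b_rotate) hij hik
      (l := σ 3) (σ.injective.ne h03) hjk (σ.injective.ne h13) (σ.injective.ne h23)
  have swap {i j : Fin (m + 4)} (hij : i ≠ j) :
      ⁅b (m + 4) i, b (m + 4) j⁆ = ⁅b (m + 4) j, b (m + 4) i⁆ := by
    obtain ⟨k, hk⟩ : ∃ k, k ∉ ({i, j} : Finset (Fin (m + 4))) := by
      by_contra! hc
      have := Finset.card_le_card (fun x _ => hc x : Finset.univ ⊆ _)
      have := Finset.card_le_two (a := i) (b := j)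
      simp at *
      omega
    simp only [Finset.mem_insert, Finset.mem_singleton, not_or] at hk
    exact (key hij (Ne.symm hk.1) (Ne.symm hk.2)).2
  have right {i j k : Fin (m + 4)} (hij : i ≠ j) (hik : i ≠ k) :
      ⁅b (m + 4) i, b (m + 4) j⁆ = ⁅b (m + 4) i, b (m + 4) k⁆ := by
    by_cases hjk : j = k
    · rw [hjk]
    · exact (key hij hik hjk).1
  by_cases hi : i = 0
  · subst hi; exact right hij h01
  · rw [right hij hi, swap hi, right (Ne.symm hi) h01]

open scoped commutatorElement in
theorem commutatorElement_b_mem_center (m : ℕ) :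
    ⁅b (m + 4) 0, b (m + 4) 1⁆ ∈ Subgroup.center (GAlt (m + 4)) := by
  obtain ⟨h01, h02, h12, h03, h13, h23⟩ := fin_zero_one_two_three_pairwise_ne m
  have hr := fun (i j k : Fin (m + 4)) => b_mul_b_mul_b_rotate (i := i) (j := j) (k := k)
  have hgen (i : Fin (m + 4)) : Commute (b (m + 4) i) ⁅b (m + 4) 0, b (m + 4) 1⁆ := by
    by_cases hi : i = 0 ∨ i = 1
    · rw [← commutatorElement_b_eq h23]
      rcases hi with rfl | rfl
      · exact commute_commutatorElement_of_rotate hr h02 h03 h23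
      · exact commute_commutatorElement_of_rotate hr h12 h13 h23
    · rw [not_or] at hi
      exact commute_commutatorElement_of_rotate hr hi.1 hi.2 h01
  have htop : Subgroup.centralizer {⁅b (m + 4) 0, b (m + 4) 1⁆} = ⊤ := by
    rw [eq_top_iff, ← PresentedGroup.closure_range_of, Subgroup.closure_le]
    rintro _ ⟨i, rfl⟩
    exact Subgroup.mem_centralizer_singleton_iff.2 (hgen i).eq
  rw [Subgroup.mem_center_iff]
  intro g
  exact Subgroup.mem_centralizer_singleton_iff.1 (htop ▸ Subgroup.mem_top g)

/-- A group generated by pairwise commuting elements is commutative. -/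
theorem mul_comm_of_closure_range_eq_top {G ι : Type*} [Group G] {a : ι → G}
    (ha : Subgroup.closure (Set.range a) = ⊤) (h : ∀ i j, Commute (a i) (a j)) (x y : G) :
    x * y = y * x := by
  have hc : Subgroup.centralizer (Set.range a) = ⊤ := by
    rw [eq_top_iff, ← ha, Subgroup.closure_le]
    rintro _ ⟨i, rfl⟩
    rw [SetLike.mem_coe, Subgroup.mem_centralizer_iff]
    rintro _ ⟨j, rfl⟩
    exact h j i
  have hx : x ∈ Subgroup.centralizer (Subgroup.closure (Set.range a) : Set G) := by
    rw [Subgroup.centralizer_closure]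
    exact hc ▸ Subgroup.mem_top x
  rw [ha] at hx
  exact (Subgroup.mem_centralizer_iff.1 hx y (Subgroup.mem_top y)).symm

/-- The exponent-sum homomorphism `Gₙ(Altₙ) → ℤⁿ`. -/
noncomputable def exponentSum (n : ℕ) : GAlt n →* Multiplicative (Fin n →₀ ℤ) :=
  PresentedGroup.toGroup (f := fun i => Multiplicative.ofAdd (Finsupp.single i 1)) <| by
    rintro _ ⟨σ, -, rfl⟩
    rw [map_mul, map_inv, mul_inv_eq_one, map_list_prod, map_list_prod, List.map_ofFn,
      List.map_ofFn, List.prod_ofFn, List.prod_ofFn]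
    simpa using (Equiv.prod_comp σ
      (fun i => Multiplicative.ofAdd (Finsupp.single i (1 : ℤ)))).symm

theorem exponentSum_b (n : ℕ) (i : Fin n) :
    exponentSum n (b n i) = Multiplicative.ofAdd (Finsupp.single i 1) :=
  PresentedGroup.toGroup.of _

theorem Csub_le_ker_exponentSum (n : ℕ) [NeZero n] : Csub n ≤ (exponentSum n).ker := by
  rw [Csub, Subgroup.zpowers_le, MonoidHom.mem_ker]
  simp only [map_mul, map_inv]
  rw [mul_inv_eq_one, mul_inv_eq_iff_eq_mul, mul_comm]

/-- in `G = Gₙ(Altₙ)` with `n ≥ 4`, the subgroup `C` generated by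
`a₁a₂a₁⁻¹a₂⁻¹` is central, and `G/C` is free abelian of rank `n` with basis the
images of `a₁,…,aₙ`. -/
theorem stmt15 (n : ℕ) (hn : 4 ≤ n) [NeZero n] :
    Csub n ≤ Subgroup.center (GAlt n) ∧
    ∀ [inst : (Csub n).Normal],
      ∃ e : GAlt n ⧸ Csub n ≃* Multiplicative (Fin n →₀ ℤ),
        ∀ i : Fin n,
          e (QuotientGroup.mk (b n i)) = Multiplicative.ofAdd (Finsupp.single i 1) := by
  obtain ⟨m, rfl⟩ := Nat.exists_eq_add_of_le' hn
  have hC : Csub (m + 4) ≤ Subgroup.center (GAlt (m + 4)) := by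
    rw [Csub, Subgroup.zpowers_le]
    exact commutatorElement_b_mem_center m
  refine ⟨hC, ?_⟩
  intro inst
  have hcomm (i j : Fin (m + 4)) : Commute (QuotientGroup.mk (b (m + 4) i) : _ ⧸ Csub (m + 4))
      (QuotientGroup.mk (b (m + 4) j)) := by
    by_cases hij : i = j
    · rw [hij]
    · rw [← commutatorElement_eq_one_iff_commute]
      change QuotientGroup.mk' (Csub (m + 4)) _ = 1
      refine (QuotientGroup.eq_one_iff _).2 ?_
      change b (m + 4) i * b (m + 4) j * (b (m + 4) i)⁻¹ * (b (m + 4) j)⁻¹ ∈ Csub (m + 4)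
      rw [← commutatorElement_def, commutatorElement_b_eq hij]
      exact Subgroup.mem_zpowers _
  have hgen : Subgroup.closure (Set.range fun i =>
      (QuotientGroup.mk (b (m + 4) i) : _ ⧸ Csub (m + 4))) = ⊤ := by
    have h := MonoidHom.map_closure (QuotientGroup.mk' (Csub (m + 4)))
      (Set.range (PresentedGroup.of (rels := GAltRels (m + 4))))
    rw [PresentedGroup.closure_range_of, Subgroup.map_top_of_surjective _
      (QuotientGroup.mk'_surjective _), ← Set.range_comp] at h
    exact h.symm
  let _ : CommGroup (GAlt (m + 4) ⧸ Csub (m + 4)) :=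
    { (inferInstance : Group (GAlt (m + 4) ⧸ Csub (m + 4))) with
      mul_comm := mul_comm_of_closure_range_eq_top hgen hcomm }
  let f := QuotientGroup.lift (Csub (m + 4)) (exponentSum (m + 4)) (Csub_le_ker_exponentSum _)
  have hf (i : Fin (m + 4)) : f (QuotientGroup.mk (b (m + 4) i)) =
      Multiplicative.ofAdd (Finsupp.single i 1) := exponentSum_b _ i
  let g : Multiplicative (Fin (m + 4) →₀ ℤ) →* GAlt (m + 4) ⧸ Csub (m + 4) :=
    AddMonoidHom.toMultiplicativeLeft (Finsupp.liftAddHom fun i =>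
      zmultiplesHom (Additive (GAlt (m + 4) ⧸ Csub (m + 4)))
        (Additive.ofMul (QuotientGroup.mk (b (m + 4) i))))
  have hg (i : Fin (m + 4)) : g (Multiplicative.ofAdd (Finsupp.single i 1)) =
      QuotientGroup.mk (b (m + 4) i) := by
    simp [g]
  refine ⟨f.toMulEquiv g ?_ ?_, hf⟩
  · refine MonoidHom.eq_of_eqOn_dense hgen ?_
    rintro _ ⟨i, rfl⟩
    simp [hf, hg]
  · refine MonoidHom.toAdditive.injective (Finsupp.addHom_ext' fun i => AddMonoidHom.ext_int ?_)
    change f (g (Multiplicative.ofAdd (Finsupp.single i 1))) = _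
    rw [hg, hf]
    rfl
end

section
/- Let n ≥ 4 be odd and M = S_n(Alt_n), with z = a_1⋯a_n (which is central since (1,2,...,n) ∈ Alt_n for odd n). Then a_1 a_1 a_2 z ≠ a_2 a_1 a_1 z in M, even though a_1 a_1 a_2 z^2 = a_2 a_1 a_1 z^2. -/
/-- `l` lists the values `σ 0, …, σ (n - 1)` of a permutation `σ` of sign `s`. -/
def IsPermWord {n : ℕ} (s : ℤˣ) (l : List (Fin n)) : Prop :=
  ∃ σ : Equiv.Perm (Fin n), Equiv.Perm.sign σ = s ∧ List.ofFn (fun i => σ i) = l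

namespace IsPermWord

variable {n : ℕ} {s t : ℤˣ} {l l' w : List (Fin n)} {x y u : Fin n}

theorem length (h : IsPermWord s l) : l.length = n := by
  obtain ⟨σ, -, rfl⟩ := h
  simp

theorem nodup (h : IsPermWord s l) : l.Nodup := by
  obtain ⟨σ, -, rfl⟩ := h
  exact List.nodup_ofFn.2 σ.injective

theorem mem (h : IsPermWord s l) (x : Fin n) : x ∈ l := by
  obtain ⟨σ, -, rfl⟩ := h
  exact List.mem_ofFn.2 (σ.surjective x)

theorem perm (h : IsPermWord s l) (h' : IsPermWord t l') : l.Perm l' :=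
  (List.perm_ext_iff_of_nodup h.nodup h'.nodup).2 fun x => iff_of_true (h.mem x) (h'.mem x)

theorem sign_unique (h : IsPermWord s l) (h' : IsPermWord t l) : s = t := by
  obtain ⟨σ, rfl, rfl⟩ := h
  obtain ⟨τ, rfl, e⟩ := h'
  have : τ = σ := Equiv.ext fun i => congrFun (List.ofFn_injective e) i
  rw [this]

theorem exists_of_nodup (hl : l.Nodup) (hn : l.length = n) : ∃ s, IsPermWord s l := by
  have hb : Function.Bijective (fun i : Fin n => l.get (i.cast hn.symm)) :=
    Finite.injective_iff_bijective.1
      ((List.nodup_iff_injective_get.1 hl).comp (Fin.cast_injective _))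
  exact ⟨_, Equiv.ofBijective _ hb, rfl, List.ext_get (by simp [hn]) (by simp)⟩

theorem swap (h : IsPermWord s (x :: y :: w)) : IsPermWord (-s) (y :: x :: w) := by
  have hlen := h.length
  simp only [List.length_cons] at hlen
  obtain ⟨m, rfl⟩ : ∃ m, n = m + 2 := ⟨_, hlen.symm⟩
  obtain ⟨σ, rfl, e⟩ := h
  simp only [List.ofFn_succ, List.cons.injEq] at e
  obtain ⟨rfl, rfl, rfl⟩ := e
  refine ⟨σ * Equiv.swap 0 1, ?_, ?_⟩
  · rw [map_mul, Equiv.Perm.sign_swap (by simp)]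
    simp
  · simp only [List.ofFn_succ, Equiv.Perm.mul_apply, List.cons.injEq]
    exact ⟨by simp, by simp, rfl⟩

theorem ofFn_mul_finRotate {m : ℕ} (σ : Equiv.Perm (Fin (m + 1))) :
    List.ofFn (fun i => (σ * finRotate (m + 1)) i) =
      List.ofFn (fun i : Fin m => σ i.succ) ++ [σ 0] := by
  rw [List.ofFn_succ', List.concat_eq_append]
  simp

theorem sign_finRotate_of_odd {m : ℕ} (h : Odd (m + 1)) :
    Equiv.Perm.sign (finRotate (m + 1)) = 1 := by
  rw [sign_finRotate]
  exact Even.neg_one_pow (by simpa [Nat.odd_add_one] using h)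

theorem rotate (hn : Odd n) (h : IsPermWord s (x :: w)) : IsPermWord s (w ++ [x]) := by
  obtain ⟨m, rfl⟩ : ∃ m, n = m + 1 := ⟨_, h.length.symm⟩
  obtain ⟨σ, rfl, e⟩ := h
  simp only [List.ofFn_succ, List.cons.injEq] at e
  obtain ⟨rfl, rfl⟩ := e
  exact ⟨σ * finRotate (m + 1), by rw [map_mul, sign_finRotate_of_odd hn, mul_one],
    ofFn_mul_finRotate σ⟩

theorem rotate_symm (hn : Odd n) (h : IsPermWord s (w ++ [x])) : IsPermWord s (x :: w) := by
  have hlen := h.length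
  simp only [List.length_append, List.length_singleton] at hlen
  obtain ⟨m, rfl⟩ : ∃ m, n = m + 1 := ⟨_, hlen.symm⟩
  obtain ⟨σ, rfl, e⟩ := h
  obtain ⟨τ, rfl⟩ : ∃ τ, σ = τ * finRotate (m + 1) := ⟨σ * (finRotate (m + 1))⁻¹, by simp⟩
  rw [ofFn_mul_finRotate] at e
  obtain ⟨rfl, e⟩ := List.append_inj' e rfl
  obtain rfl : τ 0 = x := by simpa using e
  exact ⟨τ, by rw [map_mul, sign_finRotate_of_odd hn, mul_one], List.ofFn_succ⟩

theorem rotate_append (hn : Odd n) (h : IsPermWord s (l ++ w)) : IsPermWord s (w ++ l) := by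
  induction l generalizing w with
  | nil => simpa using h
  | cons x l ih => simpa using ih (w := w ++ [x]) (by simpa using rotate hn h)

theorem cycle_three (hn : Odd n) (h : IsPermWord s (x :: y :: u :: w)) :
    IsPermWord s (y :: u :: x :: w) := by
  have h₁ : IsPermWord (-s) (x :: u :: (w ++ [y])) := rotate hn h.swap
  have h₂ := h₁.swap
  rw [neg_neg] at h₂
  exact rotate_symm hn h₂

theorem exists_cons_three (hn : Odd n) (hn' : 5 ≤ n) (hl : [x, y, u].Nodup) :
    ∃ w, IsPermWord 1 (x :: y :: u :: w) := by
  classical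
  let c := (([x, y, u].toFinset)ᶜ).toList
  have hnd : ([x, y, u] ++ c).Nodup := by
    refine List.nodup_append'.2 ⟨hl, Finset.nodup_toList _, ?_⟩
    intro v hv hv'
    simp only [c, Finset.mem_toList, Finset.mem_compl, List.mem_toFinset] at hv'
    exact hv' hv
  have hc : c.length = n - 3 := by
    simp [c, Finset.card_compl, List.toFinset_card_of_nodup hl, -List.toFinset_cons]
  obtain ⟨s, hs⟩ := exists_of_nodup hnd (by simp [hc]; omega)
  rcases Int.units_eq_one_or s with rfl | rfl
  · exact ⟨c, hs⟩
  · obtain ⟨p, q, r, hpq⟩ : ∃ p q r, c = p :: q :: r := by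
      match c, hc with
      | [], h => simp at h; omega
      | [_], h => simp at h; omega
      | p :: q :: r, _ => exact ⟨p, q, r, rfl⟩
    rw [hpq] at hs
    have h₁ := (rotate_append hn hs).swap
    rw [neg_neg] at h₁
    exact ⟨q :: p :: r, rotate_append (l := q :: p :: r) hn h₁⟩

/-- Two overlapping even permutation words at distance at most two have equal overhangs. -/
theorem eq_of_append_eq (hn : Odd n) {d d' : List (Fin n)} (h : IsPermWord 1 l)
    (h' : IsPermWord 1 l') (hl : d.length < n) (hd : d.length ≤ 2) (e : l ++ d = d' ++ l') :
    d = d' := by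
  have hlen := congrArg List.length e
  simp only [List.length_append, h.length, h'.length] at hlen
  obtain ⟨w, rfl, rfl⟩ : ∃ w, l = d' ++ w ∧ l' = w ++ d := by
    rcases List.append_eq_append_iff.1 e with ⟨w, h₁, h₂⟩ | ⟨w, h₁, h₂⟩
    · have := congrArg List.length h₁
      simp only [List.length_append, h.length] at this
      omega
    · exact ⟨w, h₁, h₂⟩
  have h₂ := rotate_append hn h'
  have hp : d.Perm d' := (List.perm_append_right_iff w).1 (h₂.perm h)
  match d, hd with
  | [], _ => exact hp.nil_eq
  | [x], _ => exact (List.perm_singleton.1 hp.symm).symm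
  | [x, y], _ =>
    have hp' : d' = [x, y] ∨ d' = [y, x] := by
      have h3 := List.mem_permutations.2 hp.symm
      simpa [List.permutations, List.permutationsAux, List.permutationsAux.rec] using h3
    rcases hp' with rfl | rfl
    · rfl
    · exact absurd (h₂.swap.sign_unique h) (by decide)

end IsPermWord

/-- Deleting an even permutation window from a word with three extra letters, not all distinct,
leaves the same three letters in the same order, whatever the window. -/
theorem remainder_unique {n : ℕ} (hn : Odd n) (hn' : 3 < n) {p w s p' w' s' : List (Fin n)}
    (hw : IsPermWord 1 w) (hw' : IsPermWord 1 w') (hle : p.length ≤ p'.length)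
    (h₃ : (p ++ s).length = 3) (hd : ¬ (p ++ s).Nodup ∨ ¬ (p' ++ s').Nodup)
    (e : p ++ w ++ s = p' ++ w' ++ s') : p ++ s = p' ++ s' := by
  have hlen := congrArg List.length e
  simp only [List.length_append, hw.length, hw'.length] at hlen h₃
  obtain ⟨d', rfl⟩ : ∃ d', p' = p ++ d' := by
    have h₁ : p <+: p' ++ w' ++ s' := ⟨w ++ s, by rw [← e]; simp⟩
    have h₂ : p' <+: p' ++ w' ++ s' := ⟨w' ++ s', by simp⟩
    obtain ⟨d, hd⟩ := List.prefix_of_prefix_length_le h₁ h₂ hle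
    exact ⟨d, hd.symm⟩
  simp only [List.length_append] at hlen
  obtain ⟨d, rfl⟩ : ∃ d, s = d ++ s' := by
    have h₁ : s' <:+ p ++ w ++ s := ⟨p ++ d' ++ w', e.symm⟩
    have h₂ : s <:+ p ++ w ++ s := ⟨p ++ w, rfl⟩
    obtain ⟨d, hd⟩ := List.suffix_of_suffix_length_le h₁ h₂ (by omega)
    exact ⟨d, hd.symm⟩
  have e' : w ++ d = d' ++ w' := by
    refine List.append_cancel_right (bs := s') (List.append_cancel_left (as := p) ?_)
    simpa only [List.append_assoc] using e
  simp only [List.length_append] at hlen h₃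
  by_cases h : d.length ≤ 2
  · rw [hw.eq_of_append_eq hn hw' (by omega) h e']
    simp
  · exfalso
    obtain rfl : p = [] := List.length_eq_zero_iff.1 (by omega)
    obtain rfl : s' = [] := List.length_eq_zero_iff.1 (by omega)
    have h₁ : d' <+: w := by
      refine List.prefix_of_prefix_length_le ⟨w', e'.symm⟩ ⟨d, rfl⟩ ?_
      rw [hw.length]; omega
    have h₂ : d <:+ w' := by
      refine List.suffix_of_suffix_length_le ⟨w, e'⟩ ⟨d', rfl⟩ ?_
      rw [hw'.length]; omega
    simp [hw.nodup.sublist h₁.sublist, hw'.nodup.sublist h₂.sublist] at hd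

/-- `l` is obtained by inserting an even permutation word into `q`. -/
def HasRemainder {n : ℕ} (q l : List (Fin n)) : Prop :=
  ∃ p w s, IsPermWord 1 w ∧ p ++ s = q ∧ l = p ++ w ++ s

theorem HasRemainder.eq {n : ℕ} (hn : Odd n) (hn' : 3 < n) {q p w s : List (Fin n)}
    (hq : q.length = 3) (hq' : ¬ q.Nodup) (hw : IsPermWord 1 w)
    (h : HasRemainder q (p ++ w ++ s)) : p ++ s = q := by
  obtain ⟨p', w', s', hw', rfl, e⟩ := h
  have hlen := congrArg List.length e
  simp only [List.length_append, hw.length, hw'.length] at hlen hq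
  rcases le_total p.length p'.length with hle | hle
  · exact remainder_unique hn hn' hw hw' hle (by simp; omega) (Or.inr hq') e
  · exact (remainder_unique hn hn' hw' hw hle (by simp; omega) (Or.inl hq') e.symm).symm

/-- Words that are interchangeable, in every context, with respect to `HasRemainder q`. -/
def remainderCon {n : ℕ} (q : List (Fin n)) : Con (FreeMonoid (Fin n)) where
  r x y := ∀ p s : FreeMonoid (Fin n),
    HasRemainder q (p * x * s).toList ↔ HasRemainder q (p * y * s).toList
  iseqv := ⟨fun _ _ _ => Iff.rfl, fun h p s => (h p s).symm, fun h h' p s => (h p s).trans (h' p s)⟩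
  mul' := by
    intro x y x' y' h h' p s
    have h₁ := h p (x' * s)
    have h₂ := h' (p * y) s
    simp only [← mul_assoc] at h₁ h₂ ⊢
    exact h₁.trans h₂

theorem isPermWord_of_mem_altH {n : ℕ} {σ : Equiv.Perm (Fin n)} (h : σ ∈ AltH n) :
    IsPermWord 1 (List.ofFn (fun i => σ i)) :=
  ⟨σ, Equiv.Perm.mem_alternatingGroup.1 h, rfl⟩

theorem isPermWord_id (n : ℕ) : IsPermWord 1 (List.ofFn (fun i : Fin n => i)) :=
  ⟨1, map_one _, rfl⟩

theorem snCon_le_remainderCon {n : ℕ} (hn : Odd n) (hn' : 3 < n) {q : List (Fin n)}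
    (hq : q.length = 3) (hq' : ¬ q.Nodup) : SnCon n (AltH n) ≤ remainderCon q := by
  refine Con.conGen_le.2 ?_
  rintro _ _ ⟨σ, hσ, rfl, rfl⟩ p s
  have h₁ := isPermWord_id n
  have h₂ := isPermWord_of_mem_altH hσ
  simp only [FreeMonoid.toList_mul, FreeMonoid.toList_ofList]
  exact ⟨fun h => ⟨_, _, _, h₂, h.eq hn hn' hq hq' h₁, rfl⟩,
    fun h => ⟨_, _, _, h₁, h.eq hn hn' hq hq' h₂, rfl⟩⟩

/-- The class in `Sₙ(Altₙ)` of a word. -/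
def wordClass {n : ℕ} (l : List (Fin n)) : SAlt n :=
  (SnCon n (AltH n)).mk' (FreeMonoid.ofList l)

theorem wordClass_append {n : ℕ} (l l' : List (Fin n)) :
    wordClass (l ++ l') = wordClass l * wordClass l' := by
  simp only [wordClass, FreeMonoid.ofList_append, map_mul]

theorem wordClass_cons {n : ℕ} (x : Fin n) (l : List (Fin n)) :
    wordClass (x :: l) = a n x * wordClass l :=
  wordClass_append [x] l

theorem IsPermWord.wordClass_eq {n : ℕ} {l : List (Fin n)} (h : IsPermWord 1 l) :
    wordClass l = z n := by
  obtain ⟨σ, hσ, rfl⟩ := h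
  refine ((Con.eq _).2 (ConGen.Rel.of _ _ ?_)).symm
  exact ⟨σ, Equiv.Perm.mem_alternatingGroup.2 hσ, rfl, rfl⟩

theorem wordClass_append_z_ne {n : ℕ} (hn : Odd n) (hn' : 3 < n) {q q' : List (Fin n)}
    (hq : q.length = 3) (hq' : ¬ q.Nodup) (hne : q' ≠ q) :
    wordClass q * z n ≠ wordClass q' * z n := by
  intro h
  have hz := isPermWord_id n
  rw [← hz.wordClass_eq, ← wordClass_append, ← wordClass_append] at h
  have h₁ := snCon_le_remainderCon hn hn' hq hq' ((Con.eq _).1 h) 1 1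
  simp only [one_mul, mul_one, FreeMonoid.toList_ofList] at h₁
  have h₂ := h₁.1 ⟨q, _, [], hz, by simp, by simp⟩
  rw [← List.append_nil (q' ++ _)] at h₂
  exact hne (by simpa using h₂.eq hn hn' hq hq' hz)

theorem a_mul_z {n : ℕ} (hn : Odd n) (x : Fin n) : a n x * z n = z n * a n x := by
  obtain ⟨w, hw⟩ : ∃ w, IsPermWord 1 (x :: w) := by
    have h := isPermWord_id n
    obtain ⟨l, r, e⟩ := List.append_of_mem (h.mem x)
    rw [e] at h
    exact ⟨_, IsPermWord.rotate_append hn h⟩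
  have h := wordClass_append (x :: w) [x]
  rw [hw.wordClass_eq, List.cons_append, wordClass_cons, (hw.rotate hn).wordClass_eq] at h
  exact h

theorem wordClass_mul_z {n : ℕ} (hn : Odd n) (l : List (Fin n)) :
    wordClass l * z n = z n * wordClass l := by
  induction l with
  | nil => exact (one_mul _).trans (mul_one _).symm
  | cons x l ih => rw [wordClass_cons, mul_assoc, ih, ← mul_assoc, a_mul_z hn, mul_assoc]

theorem wordClass_three_mul_z {n : ℕ} (hn : Odd n) (hn' : 5 ≤ n) {x y u : Fin n}
    (h : [x, y, u].Nodup) : wordClass [x, y, u] * z n = wordClass [y, u, x] * z n := by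
  obtain ⟨w, hw⟩ := IsPermWord.exists_cons_three hn hn' h
  have h₁ : IsPermWord 1 (w ++ [y, u, x]) :=
    IsPermWord.rotate_append (l := [y, u, x]) hn (hw.cycle_three hn)
  calc
    _ = wordClass ([x, y, u] ++ (w ++ [y, u, x])) := by rw [wordClass_append, h₁.wordClass_eq]
    _ = wordClass (x :: y :: u :: w ++ [y, u, x]) := rfl
    _ = z n * wordClass [y, u, x] := by rw [wordClass_append, hw.wordClass_eq]
    _ = _ := (wordClass_mul_z hn _).symm

theorem wordClass_cycle_mul_z {n : ℕ} (hn : Odd n) (hn' : 5 ≤ n) {x y u : Fin n}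
    (h : [x, y, u].Nodup) (p s : List (Fin n)) :
    wordClass (p ++ [x, y, u] ++ s) * z n = wordClass (p ++ [y, u, x] ++ s) * z n := by
  simp only [wordClass_append, mul_assoc, wordClass_mul_z hn s]
  rw [← mul_assoc (wordClass [x, y, u]), wordClass_three_mul_z hn hn' h,
    ← mul_assoc (wordClass [y, u, x])]

theorem wordClass_sq_comm_mul_z_sq {n : ℕ} (hn : Odd n) (hn' : 5 ≤ n) {x y : Fin n}
    (hxy : x ≠ y) : wordClass [x, x, y] * z n ^ 2 = wordClass [y, x, x] * z n ^ 2 := by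
  obtain ⟨u, hu⟩ : ∃ u, u ∉ ({x, y} : Finset (Fin n)) := by
    by_contra! h
    have := Finset.card_le_card (fun i _ => h i : Finset.univ ⊆ ({x, y} : Finset (Fin n)))
    have := Finset.card_le_two (a := x) (b := y)
    simp_all; omega
  obtain ⟨v, hv⟩ : ∃ v, v ∉ ({x, y, u} : Finset (Fin n)) := by
    by_contra! h
    have := Finset.card_le_card (fun i _ => h i : Finset.univ ⊆ ({x, y, u} : Finset (Fin n)))
    have := Finset.card_le_three (a := x) (b := y) (c := u)
    simp_all; omega
  obtain ⟨t, ht⟩ : ∃ t, t ∉ ({x, y, u, v} : Finset (Fin n)) := by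
    by_contra! h
    have := Finset.card_le_card (fun i _ => h i : Finset.univ ⊆ ({x, y, u, v} : Finset (Fin n)))
    have := Finset.card_le_four (a := x) (b := y) (c := u) (d := v)
    simp_all; omega
  simp only [Finset.mem_insert, Finset.mem_singleton, not_or] at hu hv ht
  obtain ⟨r, hr⟩ := IsPermWord.exists_cons_three (x := u) (y := v) (u := t) hn hn' (by grind)
  have move {i j k : Fin n} (h : [i, j, k].Nodup) (p s : List (Fin n)) :=
    wordClass_cycle_mul_z hn hn' h p (s ++ r)
  have key : wordClass ([x, x, y, u, v, t] ++ r) * z n =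
      wordClass ([y, x, x, u, v, t] ++ r) * z n :=
    calc _ = wordClass ([x, y, u, x, v, t] ++ r) * z n :=
          move (i := x) (j := y) (k := u) (by grind) [x] [v, t]
      _ = wordClass ([y, u, x, x, v, t] ++ r) * z n :=
          move (i := x) (j := y) (k := u) (by grind) [] [x, v, t]
      _ = wordClass ([y, u, x, v, t, x] ++ r) * z n :=
          move (i := x) (j := v) (k := t) (by grind) [y, u, x] []
      _ = wordClass ([y, x, v, u, t, x] ++ r) * z n :=
          move (i := u) (j := x) (k := v) (by grind) [y] [t, x]
      _ = wordClass ([y, x, v, t, x, u] ++ r) * z n :=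
          move (i := u) (j := t) (k := x) (by grind) [y, x, v] []
      _ = wordClass ([y, x, v, x, u, t] ++ r) * z n :=
          move (i := t) (j := x) (k := u) (by grind) [y, x, v] []
      _ = wordClass ([y, x, x, u, v, t] ++ r) * z n :=
          move (i := v) (j := x) (k := u) (by grind) [y, x] [t]
  have split (p : List (Fin n)) :
      wordClass p * z n ^ 2 = wordClass (p ++ u :: v :: t :: r) * z n := by
    rw [wordClass_append, hr.wordClass_eq, sq, mul_assoc]
  rw [split, split]
  exact key

theorem wordClass_three {n : ℕ} (x y u : Fin n) : wordClass [x, y, u] = a n x * a n y * a n u :=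
  (wordClass_append [x, y] [u]).trans (congrArg (· * a n u) (wordClass_append [x] [y]))

/-- in `M = Sₙ(Altₙ)` with `n ≥ 4` odd, `a₁a₁a₂z ≠ a₂a₁a₁z`
although `a₁a₁a₂z² = a₂a₁a₁z²`. -/
theorem stmt18 (n : ℕ) (hn : 4 ≤ n) (hodd : Odd n) [NeZero n] :
    a n 0 * a n 0 * a n 1 * z n ≠ a n 1 * a n 0 * a n 0 * z n ∧
      a n 0 * a n 0 * a n 1 * (z n) ^ 2 = a n 1 * a n 0 * a n 0 * (z n) ^ 2 := by
  have hn' : 5 ≤ n := by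
    obtain ⟨k, rfl⟩ := hodd
    omega
  have h01 : (0 : Fin n) ≠ 1 := by
    rw [Ne, Fin.ext_iff, Fin.val_zero, Fin.val_one', Nat.mod_eq_of_lt (by omega)]
    omega
  simp only [← wordClass_three]
  exact ⟨wordClass_append_z_ne hodd (by omega) rfl (by simp) (by simp [h01.symm]),
    wordClass_sq_comm_mul_z_sq hodd hn' h01⟩
end

section
/- Let n ≥ 3 and H a subgroup of Sym_n such that there exists an index k with σ(1) ≠ k and σ(n) ≠ k for all σ ∈ H. Let M = S_n(H) and K a field. Then the Jacobson radical of the semigroup algebra K[M] is zero. -/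
section Barrier

variable {α : Type*}

/-- The word `u` does not start with `k`, does not end with `k` and does not contain `kk`. -/
structure AvoidsBarrier (k : α) (u : List α) : Prop where
  last : ∀ p, u ≠ p ++ [k]
  first : ∀ q, u ≠ k :: q
  mid : ∀ p q, u ≠ p ++ k :: k :: q

/-- Every factorization of `u` around a barrier `kk` (possibly cut by an end of the word) is
matched by a factorization of `v` with congruent factors. -/
structure BarrierMatch (c : Con (FreeMonoid α)) (k : α) (u v : List α) : Prop where
  length_eq : u.length = v.length
  last : ∀ p, u = p ++ [k] →
    ∃ p', v = p' ++ [k] ∧ c (FreeMonoid.ofList p) (FreeMonoid.ofList p')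
  first : ∀ q, u = k :: q →
    ∃ q', v = k :: q' ∧ c (FreeMonoid.ofList q) (FreeMonoid.ofList q')
  mid : ∀ p q, u = p ++ k :: k :: q →
    ∃ p' q', v = p' ++ k :: k :: q' ∧ c (FreeMonoid.ofList p) (FreeMonoid.ofList p') ∧
      c (FreeMonoid.ofList q) (FreeMonoid.ofList q')

namespace BarrierMatch

variable {c : Con (FreeMonoid α)} {k : α} {u v w u' v' : List α}

theorem refl (u : List α) : BarrierMatch c k u u where
  length_eq := rfl
  last p h := ⟨p, h, c.refl _⟩
  first q h := ⟨q, h, c.refl _⟩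
  mid p q h := ⟨p, q, h, c.refl _, c.refl _⟩

theorem of_avoids (hu : AvoidsBarrier k u) (h : u.length = v.length) :
    BarrierMatch c k u v where
  length_eq := h
  last p h := absurd h (hu.last p)
  first q h := absurd h (hu.first q)
  mid p q h := absurd h (hu.mid p q)

theorem trans (h : BarrierMatch c k u v) (h' : BarrierMatch c k v w) : BarrierMatch c k u w where
  length_eq := h.length_eq.trans h'.length_eq
  last p hp := by
    obtain ⟨p', hp', hc⟩ := h.last p hp
    obtain ⟨p'', hp'', hc'⟩ := h'.last p' hp'
    exact ⟨p'', hp'', c.trans hc hc'⟩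
  first q hq := by
    obtain ⟨q', hq', hc⟩ := h.first q hq
    obtain ⟨q'', hq'', hc'⟩ := h'.first q' hq'
    exact ⟨q'', hq'', c.trans hc hc'⟩
  mid p q hpq := by
    obtain ⟨p', q', hpq', hp, hq⟩ := h.mid p q hpq
    obtain ⟨p'', q'', hpq'', hp', hq'⟩ := h'.mid p' q' hpq'
    exact ⟨p'', q'', hpq'', c.trans hp hp', c.trans hq hq'⟩

theorem append (h : BarrierMatch c k u v) (h' : BarrierMatch c k u' v')
    (hc : c (FreeMonoid.ofList u) (FreeMonoid.ofList v))
    (hc' : c (FreeMonoid.ofList u') (FreeMonoid.ofList v')) :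
    BarrierMatch c k (u ++ u') (v ++ v') where
  length_eq := by simp [h.length_eq, h'.length_eq]
  last p hp := by
    rcases List.eq_nil_or_concat' u' with rfl | ⟨s, a, rfl⟩
    · obtain rfl : v' = [] := List.eq_nil_of_length_eq_zero h'.length_eq.symm
      simpa using h.last p (by simpa using hp)
    · rw [← List.append_assoc] at hp
      obtain ⟨rfl, ha⟩ := List.append_inj' hp rfl
      obtain ⟨s', rfl, hs⟩ := h'.last s (by rw [ha])
      exact ⟨v ++ s', by simp, c.mul hc hs⟩
  first q hq := by
    cases u with
    | nil =>
      obtain rfl : v = [] := List.eq_nil_of_length_eq_zero h.length_eq.symm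
      exact h'.first q hq
    | cons a s =>
      obtain ⟨rfl, rfl⟩ := List.cons_eq_cons.mp hq
      obtain ⟨s', rfl, hs⟩ := h.first s rfl
      exact ⟨s' ++ v', rfl, c.mul hs hc'⟩
  mid p q hpq := by
    rcases List.append_eq_append_iff.mp hpq with ⟨s, rfl, hs⟩ | ⟨s, rfl, hs⟩
    · obtain ⟨p', q', rfl, hp, hq⟩ := h'.mid s q hs
      exact ⟨v ++ p', q', by simp, c.mul hc hp, hq⟩
    · rcases s with _ | ⟨a, _ | ⟨b, s⟩⟩
      · obtain ⟨p', q', rfl, hp, hq⟩ := h'.mid [] q (by simpa using hs.symm)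
        refine ⟨v ++ p', q', by simp, ?_, hq⟩
        simpa using c.mul hc hp
      · simp only [List.cons_append, List.nil_append, List.cons.injEq] at hs
        obtain ⟨rfl, rfl⟩ := hs
        obtain ⟨p', rfl, hp⟩ := h.last p rfl
        obtain ⟨q', rfl, hq⟩ := h'.first q rfl
        exact ⟨p', q', by simp, hp, hq⟩
      · simp only [List.cons_append, List.cons.injEq] at hs
        obtain ⟨rfl, rfl, rfl⟩ := hs
        obtain ⟨p', q', rfl, hp, hq⟩ := h.mid p s rfl
        exact ⟨p', q' ++ v', by simp, hp, c.mul hq hc'⟩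

end BarrierMatch

variable {r : FreeMonoid α → FreeMonoid α → Prop} {k : α}

theorem conGen_barrierMatch
    (hlen : ∀ x y, r x y → x.length = y.length)
    (hr : ∀ x y, r x y → AvoidsBarrier k x.toList ∧ AvoidsBarrier k y.toList)
    {x y : FreeMonoid α} (h : conGen r x y) :
    BarrierMatch (conGen r) k x.toList y.toList ∧ BarrierMatch (conGen r) k y.toList x.toList := by
  change ConGen.Rel r x y at h
  induction h with
  | of x y h =>
    exact ⟨.of_avoids (hr x y h).1 (hlen x y h), .of_avoids (hr x y h).2 (hlen x y h).symm⟩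
  | refl x => exact ⟨.refl _, .refl _⟩
  | symm _ ih => exact ih.symm
  | trans _ _ ih ih' => exact ⟨ih.1.trans ih'.1, ih'.2.trans ih.2⟩
  | mul h h' ih ih' =>
    exact ⟨ih.1.append ih'.1 h h', ih.2.append ih'.2 ((conGen r).symm h) ((conGen r).symm h')⟩

/-- If no relator interacts with `kk`, then a congruence between two words cut by `kk` at the same
position restricts to congruences between the factors. -/
theorem conGen_of_mul_barrier_mul
    (hlen : ∀ x y, r x y → x.length = y.length)
    (hr : ∀ x y, r x y → AvoidsBarrier k x.toList ∧ AvoidsBarrier k y.toList)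
    {w x w' x' : FreeMonoid α} (hw : w.length = w'.length)
    (h : conGen r (w * (.of k * .of k) * x) (w' * (.of k * .of k) * x')) :
    conGen r w w' ∧ conGen r x x' := by
  obtain ⟨p, q, hpq, hp, hq⟩ := (conGen_barrierMatch hlen hr h).1.mid w.toList x.toList (by simp)
  have hlen' : p.length = w'.length :=
    (conGen_barrierMatch hlen hr hp).1.length_eq.symm.trans hw
  have hpq' : w'.toList ++ k :: k :: x'.toList = p ++ k :: k :: q := by simpa using hpq
  obtain ⟨rfl, h2⟩ := List.append_inj hpq' hlen'.symm
  obtain rfl : x'.toList = q := by simpa using h2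
  exact ⟨hp, hq⟩

end Barrier

open MonoidAlgebra in
/-- A monoid algebra has zero Jacobson radical as soon as the monoid has a length function and an
element `z` of positive length such that `w` and `x` can be recovered from `w * z * x` and the
length of `w`. -/
theorem MonoidAlgebra.jacobson_bot_eq_bot_of_barrier {K M : Type*} [Ring K] [NoZeroDivisors K]
    [Monoid M] (len : M → ℕ) (len_mul : ∀ x y, len (x * y) = len x + len y) (z : M)
    (hz : 0 < len z)
    (hinj : ∀ w x w' x', len w = len w' → w * z * x = w' * z * x' → w = w' ∧ x = x') :
    Ideal.jacobson (⊥ : Ideal (MonoidAlgebra K M)) = ⊥ := by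
  classical
  nontriviality K
  rw [eq_bot_iff]
  intro a ha
  by_contra ha0
  obtain ⟨g, hg⟩ := Ideal.mem_jacobson_iff.mp ha (single z 1)
  rw [Ideal.mem_bot, sub_eq_zero] at hg
  have hlen1 : len (1 : M) = 0 := by simpa using len_mul 1 1
  have hg0 : g ≠ 0 := by
    rintro rfl
    simp at hg
  obtain ⟨w, hw, hwmax⟩ := g.coeff.support.exists_max_image len
    (by simpa [Finsupp.support_nonempty_iff] using hg0)
  obtain ⟨x, hx, hxmax⟩ := a.coeff.support.exists_max_image len
    (by simpa [Finsupp.support_nonempty_iff] using ha0)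
  have hgz : (g * single z 1).coeff (w * z) = g.coeff w := by
    rw [coeff_mul_single_eq_coeff_mul w, mul_one]
    intro w' hw'
    refine ⟨fun h => ?_, fun h => by rw [h]⟩
    have hl := congrArg len h
    rw [len_mul, len_mul] at hl
    exact (hinj w' 1 w 1 (by omega) (by rw [h])).1
  have huniq : UniqueMul (g * single z 1).coeff.support a.coeff.support (w * z) x := by
    intro y x' hy hx' h
    obtain ⟨w', hw', rfl⟩ := Finset.mem_image.mp (support_coeff_mul_single_subset g 1 z hy)
    have hl := congrArg len h
    simp only [len_mul] at hl
    have h1 := hwmax w' hw'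
    have h2 := hxmax x' hx'
    obtain ⟨rfl, rfl⟩ := hinj w' x' w x (by omega) h
    exact ⟨rfl, rfl⟩
  have hcoeff := congrArg (fun f => f.coeff (w * z * x)) hg
  have hgtop : g.coeff (w * z * x) = 0 := by
    by_contra hne
    have := hwmax _ (Finsupp.mem_support_iff.mpr hne)
    simp only [len_mul] at this
    omega
  have h1top : (1 : MonoidAlgebra K M).coeff (w * z * x) = 0 := by
    rw [one_def, coeff_single, Finsupp.single_eq_of_ne]
    intro h
    have := congrArg len h
    simp only [len_mul] at this
    omega
  simp only [coeff_add, Finsupp.add_apply, hgtop, h1top, add_zero,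
    coeff_mul_mul_of_uniqueMul huniq, hgz] at hcoeff
  exact mul_ne_zero (Finsupp.mem_support_iff.mp hw) (Finsupp.mem_support_iff.mp hx) hcoeff

theorem avoidsBarrier_ofFn {n : ℕ} (hn : 0 < n) {k : Fin n} (σ : Equiv.Perm (Fin n))
    (hk : σ ⟨0, hn⟩ ≠ k ∧ σ ⟨n - 1, by omega⟩ ≠ k) :
    AvoidsBarrier k (List.ofFn fun i => σ i) where
  last p h := by
    have hl := congrArg List.length h
    have hp : p.length = n - 1 := by simp at hl; omega
    have := congrArg (fun l : List (Fin n) => l[n - 1]?) h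
    simp [← hp] at this
    exact hk.2 (by simpa [hp, hn] using this)
  first q h := by
    have := congrArg (fun l : List (Fin n) => l[0]?) h
    simp [hn] at this
    exact hk.1 this
  mid p q h := by
    have hd : (List.ofFn fun i => σ i).Nodup := List.nodup_ofFn.mpr σ.injective
    rw [h] at hd
    simp [List.nodup_append] at hd

/-- if `H ≤ Symₙ` (`n ≥ 3`) and there is an index `k` with
`σ(1) ≠ k` and `σ(n) ≠ k` for all `σ ∈ H`, then the Jacobson radical of the
semigroup algebra `K[Sₙ(H)]` is zero. -/
theorem stmt19 (n : ℕ) (hn : 3 ≤ n) (H : Subgroup (Equiv.Perm (Fin n)))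
    (k : Fin n)
    (hk : ∀ σ ∈ H, σ ⟨0, by omega⟩ ≠ k ∧ σ ⟨n - 1, by omega⟩ ≠ k)
    (K : Type) [Field K] :
    Ideal.jacobson (⊥ : Ideal (MonoidAlgebra K (Sn n ↑H))) = ⊥ := by
  have hlen : ∀ x y, SnRel n ↑H x y → x.length = y.length := by
    rintro _ _ ⟨σ, -, rfl, rfl⟩
    simp [FreeMonoid.length]
  have hr : ∀ x y, SnRel n ↑H x y → AvoidsBarrier k x.toList ∧ AvoidsBarrier k y.toList := by
    rintro _ _ ⟨σ, hσ, rfl, rfl⟩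
    exact ⟨avoidsBarrier_ofFn (by omega) 1 (hk 1 H.one_mem),
      avoidsBarrier_ofFn (by omega) σ (hk σ hσ)⟩
  refine MonoidAlgebra.jacobson_bot_eq_bot_of_barrier
    (fun x => Con.liftOn x FreeMonoid.length
      fun _ _ h => (conGen_barrierMatch hlen hr h).1.length_eq)
    ?_ (gen n H k * gen n H k) Nat.two_pos ?_
  · intro x y
    induction x, y using Con.induction_on₂ with
    | H x y => exact FreeMonoid.length_mul x y
  · intro w x w' x'
    induction w, x using Con.induction_on₂ with
    | H w x =>
      induction w', x' using Con.induction_on₂ with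
      | H w' x' =>
        intro hl h
        have := conGen_of_mul_barrier_mul hlen hr hl ((Con.eq _).mp h)
        exact ⟨(Con.eq _).mpr this.1, (Con.eq _).mpr this.2⟩
end
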